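/- arXiv:1902.10894 — 4 statements merged into one kernel-verified Lean document; each statement's English description precedes it below -/
import Mathlib

section
/- Let X = (X(t), t ∈ ℝ) be a centered stationary Gaussian process with continuous sample paths and covariance function R_X, and let b > 0. Suppose R_X is strictly convex on [0, b]. Then the minimization problem min over ν ∈ M1[0,b] of I(ν) = ∫∫ R_X(t − s) ν(ds) ν(dt) has a unique optimal probability measure ν*, and the support of ν* is the entire interval [0, b]. -/
open MeasureTheory ProbabilityTheory Filter Set

/-- The topological support of a Borel measure on `ℝ`: the smallest closed set of full
measure, described as the set of points all of whose open neighbourhoods have positive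
measure. -/
def measSupport (ν : Measure ℝ) : Set ℝ :=
  {x | ∀ U : Set ℝ, IsOpen U → x ∈ U → 0 < ν U}

/-- The energy functional `I(ν) = ∫∫ R(t - s) ν(ds) ν(dt)` for a stationary covariance
kernel `R`. -/
noncomputable def statEnergy (R : ℝ → ℝ) (ν : Measure ℝ) : ℝ :=
  ∫ s, ∫ t, R (t - s) ∂ν ∂ν

section Feature

variable {Ω : Type*} [MeasurableSpace Ω] {P : Measure Ω}
  {X : ℝ → Ω → ℝ} {R : ℝ → ℝ}

theorem memLp_two_of_map_eq_gaussianReal {Y : Ω → ℝ} {v : NNReal}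
    (h : Measure.map Y P = gaussianReal 0 v) : MemLp Y 2 P := by
  have hY : AEMeasurable Y P := by
    by_contra hne
    rw [Measure.map_of_not_aemeasurable hne] at h
    exact IsProbabilityMeasure.ne_zero (gaussianReal 0 v) h.symm
  have h2 : MemLp id 2 (Measure.map Y P) := by
    rw [h]; exact memLp_id_gaussianReal 2
  exact (memLp_map_measure_iff aestronglyMeasurable_id hY).1 h2

theorem integral_sq_of_map_eq_gaussianReal {Y : Ω → ℝ} {v : NNReal}
    (h : Measure.map Y P = gaussianReal 0 v) : ∫ ω, Y ω * Y ω ∂P = v := by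
  have hY := (memLp_two_of_map_eq_gaussianReal h).aestronglyMeasurable.aemeasurable
  have h1 : ∫ ω, Y ω * Y ω ∂P = ∫ y, y * y ∂(Measure.map Y P) :=
    (integral_map (f := fun y : ℝ => y * y) hY (by fun_prop)).symm
  rw [h1, h, ← variance_fun_id_gaussianReal (μ := 0) (v := v),
    variance_eq_integral measurable_id'.aemeasurable]
  simp [integral_id_gaussianReal, pow_two]

theorem norm_integral_cexp_of_map_eq_gaussianReal {Y : Ω → ℝ} {v : NNReal}
    (h : Measure.map Y P = gaussianReal 0 v) :
    ‖∫ ω, Complex.exp (Y ω * Complex.I) ∂P‖ = Real.exp (-(v : ℝ) / 2) := by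
  have hY := (memLp_two_of_map_eq_gaussianReal h).aestronglyMeasurable.aemeasurable
  have h1 : ∫ ω, Complex.exp (Y ω * Complex.I) ∂P = charFun (Measure.map Y P) 1 := by
    rw [charFun_apply_real, integral_map hY (by fun_prop)]
    simp
  rw [h1, h, charFun_gaussianReal, Complex.norm_exp]
  simp [neg_div]

theorem exists_gaussian_one (hGauss : ∀ (n : ℕ) (t : Fin n → ℝ) (c : Fin n → ℝ),
      ∃ v : NNReal,
        Measure.map (fun ω => ∑ i, c i * X (t i) ω) P = gaussianReal 0 v) (t : ℝ) :
    ∃ v : NNReal, Measure.map (X t) P = gaussianReal 0 v := by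
  simpa using hGauss 1 (fun _ => t) (fun _ => 1)

theorem exists_gaussian_add (hGauss : ∀ (n : ℕ) (t : Fin n → ℝ) (c : Fin n → ℝ),
      ∃ v : NNReal,
        Measure.map (fun ω => ∑ i, c i * X (t i) ω) P = gaussianReal 0 v) (s t : ℝ) :
    ∃ v : NNReal, Measure.map (fun ω => X s ω + X t ω) P = gaussianReal 0 v := by
  simpa [Fin.sum_univ_two] using hGauss 2 ![s, t] (fun _ => 1)

/-- The covariance function of a stationary Gaussian process with continuous paths is
continuous. -/
theorem continuous_cov [IsProbabilityMeasure P]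
    (hGauss : ∀ (n : ℕ) (t : Fin n → ℝ) (c : Fin n → ℝ),
      ∃ v : NNReal,
        Measure.map (fun ω => ∑ i, c i * X (t i) ω) P = gaussianReal 0 v)
    (hpath : ∀ ω, Continuous fun t => X t ω)
    (hcov : ∀ s t : ℝ, (∫ ω, X s ω * X t ω ∂P) = R (t - s)) : Continuous R := by
  have hL : ∀ t, MemLp (X t) 2 P := fun t =>
    memLp_two_of_map_eq_gaussianReal (exists_gaussian_one hGauss t).choose_spec
  have hint : ∀ s t, Integrable (fun ω => X s ω * X t ω) P := fun s t =>
    (hL s).integrable_mul (hL t)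
  set g : ℝ → ℂ := fun t => ∫ ω, Complex.exp (((X 0 ω + X t ω : ℝ) : ℂ) * Complex.I) ∂P with hg
  have hgc : Continuous g := by
    refine continuous_of_dominated (bound := fun _ => 1) (fun t => ?_) (fun t => ?_)
      (integrable_const _) (Eventually.of_forall fun ω => ?_)
    · have := ((hL 0).add (hL t)).aestronglyMeasurable
      have h2 : Continuous fun y : ℝ => Complex.exp ((y : ℂ) * Complex.I) := by fun_prop
      exact h2.comp_aestronglyMeasurable this
    · exact Eventually.of_forall fun ω => (Complex.norm_exp_ofReal_mul_I _).le
    · have := hpath ω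
      fun_prop
  have hgR : ∀ t, ‖g t‖ = Real.exp (-(R 0 + R t)) := by
    intro t
    obtain ⟨v, hv⟩ := exists_gaussian_add hGauss 0 t
    have h1 := integral_sq_of_map_eq_gaussianReal hv
    rw [hg, norm_integral_cexp_of_map_eq_gaussianReal hv, ← h1]
    have h2 : ∫ ω, (X 0 ω + X t ω) * (X 0 ω + X t ω) ∂P = 2 * R 0 + 2 * R t := by
      have : ∀ ω, (X 0 ω + X t ω) * (X 0 ω + X t ω)
          = X 0 ω * X 0 ω + 2 * (X 0 ω * X t ω) + X t ω * X t ω := fun ω => by ring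
      simp_rw [this]
      rw [integral_add (by exact (hint 0 0).add ((hint 0 t).const_mul 2)) (hint t t),
        integral_add (hint 0 0) ((hint 0 t).const_mul 2), integral_const_mul, hcov, hcov, hcov]
      simp only [sub_self, sub_zero]; ring
    rw [h2]; congr 1; ring
  have hRe : R = fun t => -Real.log ‖g t‖ - R 0 := by
    ext t; rw [hgR, Real.log_exp]; ring
  rw [hRe]
  refine Continuous.sub (Continuous.neg (Continuous.log hgc.norm fun t => ?_)) continuous_const
  rw [hgR]; exact (Real.exp_pos _).ne'

/-- A stationary Gaussian process with continuous paths is a continuous curve in `L²`. -/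
theorem exists_continuous_curve [IsProbabilityMeasure P]
    (hGauss : ∀ (n : ℕ) (t : Fin n → ℝ) (c : Fin n → ℝ),
      ∃ v : NNReal,
        Measure.map (fun ω => ∑ i, c i * X (t i) ω) P = gaussianReal 0 v)
    (hpath : ∀ ω, Continuous fun t => X t ω)
    (hcov : ∀ s t : ℝ, (∫ ω, X s ω * X t ω ∂P) = R (t - s)) :
    ∃ x : ℝ → Lp ℝ 2 P, Continuous x ∧ ∀ s t, inner ℝ (x s) (x t) = R (t - s) := by
  have hL : ∀ t, MemLp (X t) 2 P := fun t =>
    memLp_two_of_map_eq_gaussianReal (exists_gaussian_one hGauss t).choose_spec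
  have hR := continuous_cov hGauss hpath hcov
  have hin : ∀ s t, inner ℝ ((hL s).toLp (X s)) ((hL t).toLp (X t)) = R (t - s) := by
    intro s t
    rw [L2.inner_def, ← hcov]
    refine integral_congr_ae ?_
    filter_upwards [(hL s).coeFn_toLp, (hL t).coeFn_toLp] with ω h1 h2
    simp [h1, h2, mul_comm]
  refine ⟨fun t => (hL t).toLp (X t), ?_, hin⟩
  rw [continuous_iff_continuousAt]
  intro s
  rw [ContinuousAt, tendsto_iff_norm_sub_tendsto_zero]
  have h1 : ∀ t, ‖(hL t).toLp (X t) - (hL s).toLp (X s)‖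
      = Real.sqrt (R 0 - 2 * R (s - t) + R 0) := by
    intro t
    rw [← Real.sqrt_sq (norm_nonneg _), norm_sub_sq_real, ← real_inner_self_eq_norm_sq,
      ← real_inner_self_eq_norm_sq, hin, hin, hin, sub_self, sub_self]
  simp_rw [h1]
  have : Continuous fun t => Real.sqrt (R 0 - 2 * R (s - t) + R 0) := by fun_prop
  have h2 := this.tendsto s
  simpa [two_mul] using h2

end Feature

/-- A continuous curve in a Hilbert space with stationary Gram kernel `R`. -/
structure IsStatCurve {H : Type*} [NormedAddCommGroup H] [InnerProductSpace ℝ H]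
    (R : ℝ → ℝ) (x : ℝ → H) : Prop where
  continuous : Continuous x
  inner_eq : ∀ s t, inner ℝ (x s) (x t) = R (t - s)

/-- `ν` is a Borel probability measure carried by `[0, b]`. -/
structure IsProbOn (b : ℝ) (ν : Measure ℝ) : Prop where
  prob : IsProbabilityMeasure ν
  compl : ν (Icc 0 b)ᶜ = 0

/-- `ν` minimizes the energy among probability measures carried by `[0, b]`. -/
structure IsOptimal (R : ℝ → ℝ) (b : ℝ) (ν : Measure ℝ) : Prop extends IsProbOn b ν where
  le : ∀ ν', IsProbOn b ν' → statEnergy R ν ≤ statEnergy R ν'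

section ProbOn

variable {b : ℝ} {ν ν₁ ν₂ : Measure ℝ}

theorem IsProbOn.ae_mem (h : IsProbOn b ν) : ∀ᵐ t ∂ν, t ∈ Icc 0 b := by
  rw [ae_iff]; exact h.compl

theorem IsProbOn.mix (h₁ : IsProbOn b ν₁) (h₂ : IsProbOn b ν₂) {l : ℝ} (hl : l ∈ Icc (0 : ℝ) 1) :
    IsProbOn b (ENNReal.ofReal l • ν₁ + ENNReal.ofReal (1 - l) • ν₂) := by
  have := h₁.prob
  have := h₂.prob
  refine ⟨⟨?_⟩, ?_⟩
  · simp [← ENNReal.ofReal_add hl.1 (sub_nonneg.2 hl.2)]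
  · simp [h₁.compl, h₂.compl]

theorem IsProbOn.map (h : IsProbOn b ν) {f : ℝ → ℝ} (hf : Measurable f)
    (hfb : ∀ᵐ t ∂ν, f t ∈ Icc 0 b) : IsProbOn b (ν.map f) := by
  have := h.prob
  refine ⟨Measure.isProbabilityMeasure_map hf.aemeasurable, ?_⟩
  rw [Measure.map_apply hf measurableSet_Icc.compl]
  exact hfb

theorem IsProbOn.reflect (h : IsProbOn b ν) : IsProbOn b (ν.map fun t => b - t) := by
  refine h.map (by fun_prop) ?_
  filter_upwards [h.ae_mem] with t ht
  exact ⟨by linarith [ht.2], by linarith [ht.1]⟩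

theorem isProbOn_dirac {t : ℝ} (ht : t ∈ Icc 0 b) : IsProbOn b (Measure.dirac t) := by
  refine ⟨inferInstance, ?_⟩
  rw [Measure.dirac_apply' _ measurableSet_Icc.compl]
  simpa using ht

theorem IsProbOn.integrable {E : Type*} [NormedAddCommGroup E]
    (h : IsProbOn b ν) {g : ℝ → E} (hg : Continuous g) : Integrable g ν := by
  have := h.prob
  obtain ⟨C, hC⟩ := isCompact_Icc.exists_bound_of_continuousOn (s := Icc 0 b) hg.continuousOn
  refine Integrable.of_bound (C := C) hg.aestronglyMeasurable ?_
  filter_upwards [h.ae_mem] with t ht using hC t ht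

end ProbOn

theorem statEnergy_map_sub {R : ℝ → ℝ} (heven : ∀ t, R (-t) = R t)
    (ν : Measure ℝ) (b : ℝ) : statEnergy R (ν.map fun t => b - t) = statEnergy R ν := by
  have he : MeasurableEmbedding fun t : ℝ => b - t :=
    (Homeomorph.subLeft b).measurableEmbedding
  simp only [statEnergy]
  rw [he.integral_map]
  refine integral_congr_ae (Eventually.of_forall fun s => ?_)
  simp only
  rw [he.integral_map]
  refine integral_congr_ae (Eventually.of_forall fun t => ?_)
  simp only
  rw [← heven]; congr 1; ring

theorem statEnergy_map_add (R : ℝ → ℝ) (ν : Measure ℝ) (a : ℝ) :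
    statEnergy R (ν.map fun t => t + a) = statEnergy R ν := by
  have he : MeasurableEmbedding fun t : ℝ => t + a :=
    (Homeomorph.addRight a).measurableEmbedding
  simp only [statEnergy]
  rw [he.integral_map]
  refine integral_congr_ae (Eventually.of_forall fun s => ?_)
  simp only
  rw [he.integral_map]
  refine integral_congr_ae (Eventually.of_forall fun t => ?_)
  simp only
  congr 1; ring

namespace IsStatCurve

variable {H : Type*} [NormedAddCommGroup H] [InnerProductSpace ℝ H]
  {R : ℝ → ℝ} {x : ℝ → H} {b : ℝ} {ν ν₁ ν₂ : Measure ℝ}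

theorem even (hx : IsStatCurve R x) (t : ℝ) : R (-t) = R t := by
  have h1 := hx.inner_eq 0 t
  have h2 := hx.inner_eq t 0
  rw [real_inner_comm] at h2
  rw [sub_zero] at h1
  rw [zero_sub] at h2
  exact h2.symm.trans h1

theorem integral_mix (hx : IsStatCurve R x) (h₁ : IsProbOn b ν₁) (h₂ : IsProbOn b ν₂) {l : ℝ}
    (hl : l ∈ Icc (0 : ℝ) 1) :
    ∫ s, x s ∂(ENNReal.ofReal l • ν₁ + ENNReal.ofReal (1 - l) • ν₂)
      = l • (∫ s, x s ∂ν₁) + (1 - l) • (∫ s, x s ∂ν₂) := by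
  rw [integral_add_measure ((h₁.integrable hx.continuous).smul_measure (by simp))
    ((h₂.integrable hx.continuous).smul_measure (by simp)), integral_smul_measure,
    integral_smul_measure, ENNReal.toReal_ofReal hl.1, ENNReal.toReal_ofReal (sub_nonneg.2 hl.2)]

theorem isOptimal_reflect (hx : IsStatCurve R x) (h : IsOptimal R b ν) :
    IsOptimal R b (ν.map fun t => b - t) := by
  refine ⟨h.toIsProbOn.reflect, fun ν' h' => ?_⟩
  rw [statEnergy_map_sub hx.even]
  exact h.le ν' h'

variable [CompleteSpace H]

theorem inner_integral (hx : IsStatCurve R x) (hν : IsProbOn b ν) (t : ℝ) :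
    inner ℝ (x t) (∫ s, x s ∂ν) = ∫ s, R (s - t) ∂ν := by
  rw [← integral_inner (hν.integrable hx.continuous)]
  simp_rw [hx.inner_eq]

theorem inner_integral_integral (hx : IsStatCurve R x) (hν : IsProbOn b ν) (z : H) :
    inner ℝ z (∫ s, x s ∂ν) = ∫ s, inner ℝ (x s) z ∂ν := by
  rw [← integral_inner (hν.integrable hx.continuous)]
  simp_rw [real_inner_comm]

theorem statEnergy_eq (hx : IsStatCurve R x) (hν : IsProbOn b ν) :
    statEnergy R ν = ‖∫ s, x s ∂ν‖ ^ 2 := by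
  rw [← real_inner_self_eq_norm_sq, hx.inner_integral_integral hν, statEnergy]
  simp_rw [hx.inner_integral hν]

theorem norm_sq_le_inner (hx : IsStatCurve R x) (h : IsOptimal R b ν₁) (h₂ : IsProbOn b ν₂) :
    ‖∫ s, x s ∂ν₁‖ ^ 2 ≤ inner ℝ (∫ s, x s ∂ν₁) (∫ s, x s ∂ν₂) := by
  set m := ∫ s, x s ∂ν₁
  set m' := ∫ s, x s ∂ν₂
  have key : ∀ l ∈ Ioc (0 : ℝ) 1, 0 ≤ 2 * inner ℝ m (m' - m) + l * ‖m' - m‖ ^ 2 := by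
    intro l hl
    have hl' : l ∈ Icc (0 : ℝ) 1 := ⟨hl.1.le, hl.2⟩
    have h1 := h.le _ (h₂.mix h.toIsProbOn hl')
    rw [hx.statEnergy_eq h.toIsProbOn, hx.statEnergy_eq (h₂.mix h.toIsProbOn hl'),
      hx.integral_mix h₂ h.toIsProbOn hl'] at h1
    have h2 : l • m' + (1 - l) • m = m + l • (m' - m) := by module
    change ‖m‖ ^ 2 ≤ ‖l • m' + (1 - l) • m‖ ^ 2 at h1
    rw [h2, norm_add_sq_real, norm_smul, inner_smul_right, mul_pow, Real.norm_eq_abs, sq_abs] at h1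
    have h3 : 0 ≤ l * (2 * inner ℝ m (m' - m) + l * ‖m' - m‖ ^ 2) := by linarith
    exact nonneg_of_mul_nonneg_right h3 hl.1
  have h4 : 0 ≤ 2 * inner ℝ m (m' - m) + 0 * ‖m' - m‖ ^ 2 := by
    have hc : Continuous fun l : ℝ => 2 * inner ℝ m (m' - m) + l * ‖m' - m‖ ^ 2 := by fun_prop
    refine ge_of_tendsto ((hc.tendsto 0).mono_left (nhdsWithin_le_nhds (s := Ioi 0))) ?_
    filter_upwards [Ioc_mem_nhdsGT (zero_lt_one' ℝ)] with l hl using key l hl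
  rw [inner_sub_right, real_inner_self_eq_norm_sq] at h4
  linarith

theorem integral_eq_of_isOptimal (hx : IsStatCurve R x) (h₁ : IsOptimal R b ν₁)
    (h₂ : IsOptimal R b ν₂) : ∫ s, x s ∂ν₁ = ∫ s, x s ∂ν₂ := by
  have a1 := hx.norm_sq_le_inner h₁ h₂.toIsProbOn
  have a2 := hx.norm_sq_le_inner h₂ h₁.toIsProbOn
  rw [real_inner_comm] at a2
  have := norm_sub_sq_real (∫ s, x s ∂ν₁) (∫ s, x s ∂ν₂)
  rw [← sub_eq_zero, ← norm_eq_zero]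
  have h0 : ‖∫ s, x s ∂ν₁ - ∫ s, x s ∂ν₂‖ ^ 2 ≤ 0 := by linarith
  nlinarith [norm_nonneg (∫ s, x s ∂ν₁ - ∫ s, x s ∂ν₂)]

theorem potential_eq_of_isOptimal (hx : IsStatCurve R x) (h₁ : IsOptimal R b ν₁)
    (h₂ : IsOptimal R b ν₂) (t : ℝ) : ∫ s, R (s - t) ∂ν₁ = ∫ s, R (s - t) ∂ν₂ := by
  rw [← hx.inner_integral h₁.toIsProbOn, ← hx.inner_integral h₂.toIsProbOn,
    hx.integral_eq_of_isOptimal h₁ h₂]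

theorem isOptimal_of_potential_eq (hx : IsStatCurve R x) (h : IsProbOn b ν) {C : ℝ}
    (hC : ∀ t ∈ Icc 0 b, ∫ s, R (s - t) ∂ν = C) : IsOptimal R b ν := by
  refine ⟨h, fun ν' h' => ?_⟩
  set m := ∫ s, x s ∂ν with hm
  have key : ∀ κ, IsProbOn b κ → inner ℝ m (∫ s, x s ∂κ) = C := by
    intro κ hκ
    have := hκ.prob
    rw [hx.inner_integral_integral hκ]
    have : ∫ s, inner ℝ (x s) m ∂κ = ∫ _, C ∂κ := by
      refine integral_congr_ae ?_
      filter_upwards [hκ.ae_mem] with t ht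
      rw [hm, hx.inner_integral h, hC t ht]
    simp [this]
  have k1 := key ν h
  have k2 := key ν' h'
  rw [hx.statEnergy_eq h, hx.statEnergy_eq h']
  rw [← hm, real_inner_self_eq_norm_sq] at k1
  have := norm_sub_sq_real m (∫ s, x s ∂ν')
  nlinarith [sq_nonneg ‖m - ∫ s, x s ∂ν'‖]

theorem isOptimal_mix (hx : IsStatCurve R x) (h₁ : IsOptimal R b ν₁) (h₂ : IsOptimal R b ν₂) {l : ℝ}
    (hl : l ∈ Icc (0 : ℝ) 1) :
    IsOptimal R b (ENNReal.ofReal l • ν₁ + ENNReal.ofReal (1 - l) • ν₂) := by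
  have h := h₁.toIsProbOn.mix h₂.toIsProbOn hl
  refine ⟨h, fun ν' h' => ?_⟩
  rw [hx.statEnergy_eq h, hx.integral_mix h₁.toIsProbOn h₂.toIsProbOn hl,
    hx.integral_eq_of_isOptimal h₁ h₂, ← add_smul, add_sub_cancel, one_smul,
    ← hx.statEnergy_eq h₂.toIsProbOn]
  exact h₂.le ν' h'

end IsStatCurve

theorem exists_isOptimal {R : ℝ → ℝ} (hR : Continuous R) {b : ℝ} (hb : 0 < b) :
    ∃ ν, IsOptimal R b ν := by
  have : Nonempty (Icc (0 : ℝ) b) := ⟨⟨0, le_rfl, hb.le⟩⟩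
  have : Nonempty (ProbabilityMeasure (Icc (0 : ℝ) b)) :=
    ⟨⟨Measure.dirac ⟨0, le_rfl, hb.le⟩, inferInstance⟩⟩
  have he : MeasurableEmbedding (Subtype.val : Icc (0 : ℝ) b → ℝ) :=
    MeasurableEmbedding.subtype_coe measurableSet_Icc
  let f : BoundedContinuousFunction (Icc (0 : ℝ) b × Icc (0 : ℝ) b) ℝ :=
    BoundedContinuousFunction.mkOfCompact
      ⟨fun p => R ((p.2 : ℝ) - (p.1 : ℝ)), by fun_prop⟩
  have hE : ∀ κ : ProbabilityMeasure (Icc (0 : ℝ) b),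
      statEnergy R ((κ : Measure (Icc (0 : ℝ) b)).map Subtype.val)
        = ∫ p, f p ∂((κ.prod κ : ProbabilityMeasure _) : Measure _) := by
    intro κ
    rw [ProbabilityMeasure.toMeasure_prod, integral_prod _ (f.integrable _), statEnergy,
      he.integral_map]
    refine integral_congr_ae (Eventually.of_forall fun s => ?_)
    simp only
    rw [he.integral_map]
    rfl
  have hc : Continuous fun κ : ProbabilityMeasure (Icc (0 : ℝ) b) =>
      statEnergy R ((κ : Measure (Icc (0 : ℝ) b)).map Subtype.val) := by
    simp_rw [hE]
    exact (ProbabilityMeasure.continuous_integral_boundedContinuousFunction f).comp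
      (ProbabilityMeasure.continuous_prod.comp (continuous_id.prodMk continuous_id))
  obtain ⟨κ, -, hκ⟩ := isCompact_univ.exists_isMinOn univ_nonempty hc.continuousOn
  refine ⟨(κ : Measure _).map Subtype.val,
    ⟨Measure.isProbabilityMeasure_map he.measurable.aemeasurable, ?_⟩, fun ν' h' => ?_⟩
  · rw [he.map_apply]
    convert measure_empty (μ := (κ : Measure (Icc (0 : ℝ) b)))
    ext t; simp
  · have := h'.prob
    have hp : IsProbabilityMeasure (ν'.comap (Subtype.val : Icc (0 : ℝ) b → ℝ)) := by
      refine ⟨?_⟩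
      rw [he.comap_apply, image_univ, Subtype.range_coe,
        prob_compl_eq_zero_iff measurableSet_Icc |>.1 h'.compl]
    have hm : (ν'.comap (Subtype.val : Icc (0 : ℝ) b → ℝ)).map Subtype.val = ν' := by
      rw [he.map_comap, Subtype.range_coe]
      exact Measure.restrict_eq_self_of_ae_mem h'.ae_mem
    have := isMinOn_iff.1 hκ ⟨_, hp⟩ (mem_univ _)
    simpa [hm] using this

section Cdf

variable {b : ℝ} {ν ν₁ ν₂ : Measure ℝ}

theorem IsProbOn.cdf_eq_one (h : IsProbOn b ν) {t : ℝ} (ht : b ≤ t) : cdf ν t = 1 := by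
  have := h.prob
  rw [cdf_eq_real, Measure.real]
  have h1 : ν (Iic t) = 1 := by
    rw [← measure_univ (μ := ν)]
    refine measure_congr ?_
    filter_upwards [h.ae_mem] with s hs
    exact propext ⟨fun _ => trivial, fun _ => hs.2.trans ht⟩
  simp [h1]

theorem IsProbOn.cdf_eq_zero (h : IsProbOn b ν) {t : ℝ} (ht : t < 0) : cdf ν t = 0 := by
  have := h.prob
  rw [cdf_eq_real, Measure.real]
  have h1 : ν (Iic t) = 0 := by
    refine measure_mono_null (fun s hs => ?_) h.compl
    exact fun hs' => absurd (hs'.1.trans hs) (not_le.2 ht)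
  simp [h1]

theorem intervalIntegrable_cdf (ν : Measure ℝ) (p q : ℝ) :
    IntervalIntegrable (cdf ν) volume p q := (monotone_cdf ν).intervalIntegrable

/-- Integration by parts against the distribution function. -/
theorem IsProbOn.integral_cdf_mul (h : IsProbOn b ν) (hb : 0 ≤ b) {g : ℝ → ℝ}
    (hg : Continuous g) :
    ∫ t in 0..b, cdf ν t * g t = ∫ r, (∫ t in r..b, g t) ∂ν := by
  have := h.prob
  have h1 : ∀ t, cdf ν t * g t = ∫ r, (Iic t).indicator (fun _ => g t) r ∂ν := by
    intro t
    rw [integral_indicator_const _ measurableSet_Iic, cdf_eq_real, smul_eq_mul]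
  obtain ⟨C, hC⟩ := isCompact_Icc.exists_bound_of_continuousOn (s := Icc 0 b) hg.continuousOn
  have hset : MeasurableSet {p : ℝ × ℝ | p.2 ≤ p.1} := measurableSet_le measurable_snd measurable_fst
  rw [intervalIntegral.integral_of_le hb]
  simp_rw [h1]
  rw [integral_integral_swap]
  · refine integral_congr_ae ?_
    filter_upwards [h.ae_mem] with r hr
    have h2 : ∀ t, (Iic t).indicator (fun _ => g t) r = (Ici r).indicator g t := by
      intro t; simp [indicator_apply]
    simp_rw [h2]
    rw [setIntegral_indicator measurableSet_Ici, intervalIntegral.integral_of_le hr.2,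
      ← integral_Icc_eq_integral_Ioc]
    refine setIntegral_congr_set ?_
    have h3 : (Ioc 0 b ∩ Ici r : Set ℝ) =ᵐ[volume] (Icc 0 b ∩ Ici r : Set ℝ) :=
      Ioc_ae_eq_Icc.inter (ae_eq_refl _)
    have h4 : Icc 0 b ∩ Ici r = Icc r b := by
      ext t; simp only [mem_inter_iff, mem_Icc, mem_Ici]
      exact ⟨fun ⟨h, h'⟩ => ⟨h', h.2⟩, fun ⟨h, h'⟩ => ⟨⟨hr.1.trans h, h'⟩, h⟩⟩
    rw [← h4]
    exact h3
  · refine Integrable.of_bound (C := C) ?_ ?_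
    · have : (Function.uncurry fun t r => (Iic t).indicator (fun _ => g t) r)
          = {p : ℝ × ℝ | p.2 ≤ p.1}.indicator fun p => g p.1 := by
        ext ⟨t, r⟩; simp [indicator_apply]
      rw [this]
      exact ((hg.measurable.comp measurable_fst).indicator hset).aestronglyMeasurable
    · have h5 : ∀ᵐ p : ℝ × ℝ ∂((volume.restrict (Ioc 0 b)).prod ν), p.1 ∈ Ioc 0 b :=
        Measure.quasiMeasurePreserving_fst.ae (ae_restrict_mem measurableSet_Ioc)
      filter_upwards [h5] with p hp
      have h6 := hC p.1 ⟨hp.1.le, hp.2⟩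
      refine le_trans ?_ h6
      simp only [Function.uncurry]
      exact norm_indicator_le_norm_self (fun _ => g p.1) p.2

theorem IsProbOn.integral_cdf (h : IsProbOn b ν) (hb : 0 ≤ b) :
    ∫ t in 0..b, cdf ν t = b - ∫ r, r ∂ν := by
  have := h.prob
  have h1 := h.integral_cdf_mul hb (g := fun _ => 1) continuous_const
  simp only [mul_one, intervalIntegral.integral_const, smul_eq_mul] at h1
  rw [h1, integral_sub (integrable_const b) (h.integrable continuous_id')]
  simp

/-- The `L¹` modulus of continuity of a distribution function. -/
theorem integral_cdf_shift_le (ν : Measure ℝ) (b : ℝ) {y : ℝ} (hy : 0 ≤ y) (p : ℝ) :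
    ∫ t in p..p + b, (cdf ν (t + y) - cdf ν t) ≤ y := by
  have hi := intervalIntegrable_cdf ν
  have hmono := monotone_cdf ν
  have hmono' : Monotone fun t => cdf ν (t + y) := fun _ _ h => hmono (by linarith)
  rw [intervalIntegral.integral_sub hmono'.intervalIntegrable (hi _ _),
    intervalIntegral.integral_comp_add_right (fun t => cdf ν t) y]
  have e1 := intervalIntegral.integral_add_adjacent_intervals (hi p (p + y)) (hi (p + y) (p + b + y))
  have e2 := intervalIntegral.integral_add_adjacent_intervals (hi p (p + b))
    (hi (p + b) (p + b + y))
  have i1 : 0 ≤ ∫ t in p..p + y, cdf ν t :=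
    intervalIntegral.integral_nonneg (by linarith) fun t _ => cdf_nonneg ν t
  have i2 : ∫ t in p + b..p + b + y, cdf ν t ≤ ∫ t in p + b..p + b + y, (1 : ℝ) :=
    intervalIntegral.integral_mono_on (by linarith) (hi _ _) (by simp) fun t _ => cdf_le_one ν t
  simp at i2
  linarith

/-- If two measures on `[0, b]` have the same potential, then the difference of their distribution
functions has constant potential. -/
theorem IsProbOn.integral_cdf_sub_mul_kernel (h₁ : IsProbOn b ν₁) (h₂ : IsProbOn b ν₂) (hb : 0 ≤ b)
    {R : ℝ → ℝ} (hR : Continuous R)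
    (hnull : ∀ t, ∫ s, R (s - t) ∂ν₁ = ∫ s, R (s - t) ∂ν₂) (s : ℝ) :
    ∫ t in 0..b, (cdf ν₁ t - cdf ν₂ t) * R (t - s)
      = ∫ t in 0..b, (cdf ν₁ t - cdf ν₂ t) * R t := by
  have key : ∀ ν, IsProbOn b ν → (∫ t in 0..b, cdf ν t * R (t - s)) - ∫ t in 0..b, cdf ν t * R t
      = (∫ t in b - s..b, -R t) + ∫ τ in 0..s, ∫ r, R (r - τ) ∂ν := by
    intro ν hν
    have := hν.prob
    rw [hν.integral_cdf_mul hb (g := fun t => R (t - s)) (by fun_prop), hν.integral_cdf_mul hb hR]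
    have hii : ∀ p q, IntervalIntegrable R volume p q := fun p q => hR.intervalIntegrable p q
    have hc1 : Continuous fun r => ∫ t in r..b, R (t - s) := by
      have : (fun r => ∫ t in r..b, R (t - s)) = fun r => -∫ t in b..r, R (t - s) := by
        ext r; rw [intervalIntegral.integral_symm]
      rw [this]
      exact (intervalIntegral.continuous_primitive
        (fun p q => (by fun_prop : Continuous fun t => R (t - s)).intervalIntegrable p q) b).neg
    have hc2 : Continuous fun r => ∫ t in r..b, R t := by
      have : (fun r => ∫ t in r..b, R t) = fun r => -∫ t in b..r, R t := by
        ext r; rw [intervalIntegral.integral_symm]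
      rw [this]
      exact (intervalIntegral.continuous_primitive hii b).neg
    rw [← integral_sub (hν.integrable hc1) (hν.integrable hc2)]
    have hpt : ∀ r, (∫ t in r..b, R (t - s)) - ∫ t in r..b, R t
        = (∫ t in b - s..b, -R t) + ∫ τ in 0..s, R (r - τ) := by
      intro r
      rw [intervalIntegral.integral_comp_sub_right, intervalIntegral.integral_neg,
        intervalIntegral.integral_comp_sub_left, sub_zero]
      have e1 := intervalIntegral.integral_add_adjacent_intervals (hii (r - s) (b - s)) (hii (b - s) b)
      have e2 := intervalIntegral.integral_add_adjacent_intervals (hii (r - s) r) (hii r b)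
      linarith
    simp_rw [hpt]
    have hc3 : Continuous fun p : ℝ × ℝ => R (p.1 - p.2) := by fun_prop
    have hc4 : Continuous fun r => ∫ τ in 0..s, R (r - τ) :=
      intervalIntegral.continuous_parametric_intervalIntegral_of_continuous' hc3 0 s
    rw [integral_add (integrable_const _) (hν.integrable hc4)]
    congr 1
    · simp
    · rw [intervalIntegral_integral_swap]
      obtain ⟨C, hC⟩ := (isCompact_Icc.prod isCompact_uIcc).exists_bound_of_continuousOn
        (s := Icc 0 b ×ˢ uIcc 0 s) hc3.continuousOn
      have : IsFiniteMeasure (volume.restrict (uIoc 0 s)) := by unfold uIoc; infer_instance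
      refine Integrable.of_bound (C := C) (by fun_prop) ?_
      have h5 : ∀ᵐ p : ℝ × ℝ ∂((volume.restrict (uIoc 0 s)).prod ν), p.1 ∈ uIoc 0 s :=
        Measure.quasiMeasurePreserving_fst.ae (ae_restrict_mem measurableSet_uIoc)
      have h6 : ∀ᵐ p : ℝ × ℝ ∂((volume.restrict (uIoc 0 s)).prod ν), p.2 ∈ Icc 0 b :=
        Measure.quasiMeasurePreserving_snd.ae hν.ae_mem
      filter_upwards [h5, h6] with p hp hp'
      exact hC (p.2, p.1) ⟨hp', uIoc_subset_uIcc hp⟩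
  have hi : ∀ (ν : Measure ℝ) (y : ℝ),
      IntervalIntegrable (fun t => cdf ν t * R (t - y)) volume 0 b := fun ν y =>
    (intervalIntegrable_cdf ν 0 b).mul_continuousOn (by fun_prop)
  have hi0 : ∀ (ν : Measure ℝ),
      IntervalIntegrable (fun t => cdf ν t * R t) volume 0 b := fun ν =>
    (intervalIntegrable_cdf ν 0 b).mul_continuousOn (by fun_prop)
  simp_rw [sub_mul]
  rw [intervalIntegral.integral_sub (hi _ _) (hi _ _), intervalIntegral.integral_sub (hi0 _) (hi0 _)]
  have k1 := key ν₁ h₁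
  have k2 := key ν₂ h₂
  simp_rw [hnull] at k1
  linarith

end Cdf

section SecondDifference

theorem ConvexOn.two_mul_le_add {f : ℝ → ℝ} {s : Set ℝ} (hf : ConvexOn ℝ s f) {y h : ℝ}
    (h₁ : y + h ∈ s) (h₂ : y - h ∈ s) : 2 * f y ≤ f (y + h) + f (y - h) := by
  have := hf.2 h₁ h₂ (by norm_num : (0 : ℝ) ≤ 1 / 2) (by norm_num : (0 : ℝ) ≤ 1 / 2)
    (by norm_num)
  simp only [smul_eq_mul] at this
  rw [show 1 / 2 * (y + h) + 1 / 2 * (y - h) = y by ring] at this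
  linarith

/-- The second differences of a strictly convex function have integrals of order at least
`h ^ 2`. -/
theorem StrictConvexOn.exists_integral_second_difference_le {f : ℝ → ℝ} {b y z : ℝ}
    (hf : StrictConvexOn ℝ (Icc 0 b) f) (hc : Continuous f) (hy : 0 < y) (hyz : y < z)
    (hz : z < b) :
    ∃ κ > 0, ∃ h₀ > 0, ∀ h, 0 < h → h < h₀ →
      ∫ t in y..z, (2 * f t - f (t + h) - f (t - h)) ≤ -(κ * h ^ 2) := by
  set d := z - y with hd
  have hd0 : 0 < d := by linarith
  set w₁ := y + d / 3 with hw1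
  set w₂ := y + d / 2 with hw2
  set w₃ := y + 2 * d / 3 with hw3
  have hmem : ∀ w, 0 ≤ w → w ≤ b → w ∈ Icc 0 b := fun w h1 h2 => ⟨h1, h2⟩
  have hstrict := hf.slope_strict_mono_adjacent (x := w₁) (y := w₂) (z := w₃)
    (hmem _ (by linarith) (by linarith)) (hmem _ (by linarith) (by linarith))
    (by linarith) (by linarith)
  have hcv := hf.convexOn
  refine ⟨(f w₃ - f w₂) / (w₃ - w₂) - (f w₂ - f w₁) / (w₂ - w₁), by linarith,
    min (d / 3) (min y (b - z)), by simp only [gt_iff_lt, lt_min_iff]; exact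
      ⟨by linarith, hy, by linarith⟩, fun h h0 hh => ?_⟩
  set κ := (f w₃ - f w₂) / (w₃ - w₂) - (f w₂ - f w₁) / (w₂ - w₁) with hκ
  rw [lt_min_iff, lt_min_iff] at hh
  obtain ⟨hh1, hh2, hh3⟩ := hh
  set D : ℝ → ℝ := fun t => f (t + h) - f t with hD
  have hDc : Continuous D := by fun_prop
  have hDi : ∀ p q, IntervalIntegrable D volume p q := fun p q => hDc.intervalIntegrable p q
  have e1 : ∫ t in y..z, (2 * f t - f (t + h) - f (t - h))
      = -∫ t in y - h..y, (D (t + d) - D t) := by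
    have e2 : ∫ t in y..z, (2 * f t - f (t + h) - f (t - h))
        = ∫ t in y..z, (D (t - h) - D t) := by
      congr 1; ext t; simp only [hD, sub_add_cancel]; ring
    have i1 : IntervalIntegrable (fun t => D (t - h)) volume y z :=
      (by fun_prop : Continuous fun t => D (t - h)).intervalIntegrable _ _
    have i2 : IntervalIntegrable (fun t => D (t + d)) volume (y - h) y :=
      (by fun_prop : Continuous fun t => D (t + d)).intervalIntegrable _ _
    rw [e2, intervalIntegral.integral_sub i1 (hDi _ _),
      intervalIntegral.integral_sub i2 (hDi _ _),
      intervalIntegral.integral_comp_sub_right, intervalIntegral.integral_comp_add_right,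
      show y - h + d = z - h by rw [hd]; ring, show y + d = z by rw [hd]; ring]
    have a1 := intervalIntegral.integral_add_adjacent_intervals (hDi (y - h) y) (hDi y z)
    have a2 := intervalIntegral.integral_add_adjacent_intervals (hDi (y - h) (z - h))
      (hDi (z - h) z)
    linarith
  have hpt : ∀ t ∈ Icc (y - h) y, h * κ ≤ D (t + d) - D t := by
    intro t ht
    have b1 := hcv.slope_mono_adjacent (x := t) (y := t + h) (z := w₁)
      (hmem _ (by linarith [ht.1]) (by linarith [ht.2])) (hmem _ (by linarith) (by linarith))
      (by linarith) (by linarith [ht.2])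
    have b2 := hcv.slope_mono_adjacent (x := t + h) (y := w₁) (z := w₂)
      (hmem _ (by linarith [ht.1]) (by linarith [ht.2])) (hmem _ (by linarith) (by linarith))
      (by linarith [ht.2]) (by linarith)
    have b3 := hcv.slope_mono_adjacent (x := w₂) (y := w₃) (z := t + d)
      (hmem _ (by linarith) (by linarith)) (hmem _ (by linarith [ht.1]) (by linarith [ht.2]))
      (by linarith) (by linarith [ht.1])
    have b4 := hcv.slope_mono_adjacent (x := w₃) (y := t + d) (z := t + d + h)
      (hmem _ (by linarith) (by linarith)) (hmem _ (by linarith [ht.1]) (by linarith [ht.2]))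
      (by linarith [ht.1]) (by linarith)
    rw [add_sub_cancel_left] at b1 b4
    have b5 : κ ≤ (f (t + d + h) - f (t + d)) / h - (f (t + h) - f t) / h := by
      rw [hκ]; linarith
    rw [← sub_div, le_div_iff₀ h0] at b5
    simp only [hD]
    linarith
  have e3 : ∫ t in y - h..y, h * κ ≤ ∫ t in y - h..y, (D (t + d) - D t) :=
    intervalIntegral.integral_mono_on (by linarith) (by simp)
      ((by fun_prop : Continuous fun t => D (t + d) - D t).intervalIntegrable _ _) hpt
  rw [intervalIntegral.integral_const, smul_eq_mul] at e3
  rw [e1]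
  nlinarith

theorem StrictConvexOn.exists_integral_second_difference_mul_neg {f B : ℝ → ℝ} {b y z m : ℝ}
    (hf : StrictConvexOn ℝ (Icc 0 b) f) (hc : Continuous f)
    (hsmall : ∀ ε > 0, ∃ h₀ > 0, ∀ h, 0 < h → h < h₀ →
      ∀ t, 2 * f t - f (t + h) - f (t - h) ≤ ε)
    (hy : 0 < y) (hyz : y < z) (hz : z < b)
    (hBm : Measurable B) (hB0 : ∀ t, 0 ≤ B t) (hB1 : ∀ t, 0 ≤ t → B t ≤ 4 * t)
    (hB2 : ∀ t ∈ Icc 0 b, B t ≤ 2 * (b - t)) (hm : 0 < m) (hBw : ∀ t ∈ Icc y z, m ≤ B t) :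
    ∃ h, ∫ t in 0..b, (2 * f t - f (t + h) - f (t - h)) * B t < 0 := by
  obtain ⟨κ, hκ, h₀, hh₀, hwin⟩ := hf.exists_integral_second_difference_le hc hy hyz hz
  obtain ⟨h₁, hh₁, hε⟩ := hsmall (m * κ / 7) (by positivity)
  set ε := m * κ / 7 with hεdef
  have hε0 : 0 < ε := by positivity
  obtain ⟨h, h0, hh⟩ : ∃ h, 0 < h ∧ h < min (min h₀ h₁) (min y (b - z)) :=
    exists_between (by simp only [lt_min_iff]; exact ⟨⟨hh₀, hh₁⟩, hy, by linarith⟩)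
  simp only [lt_min_iff] at hh
  obtain ⟨⟨hl0, hl1⟩, hl2, hl3⟩ := hh
  refine ⟨h, ?_⟩
  set K : ℝ → ℝ := fun t => 2 * f t - f (t + h) - f (t - h) with hK
  have hKc : Continuous K := by fun_prop
  have hi : ∀ p q, 0 ≤ p → p ≤ q → IntervalIntegrable (fun t => K t * B t) volume p q := by
    intro p q hp hpq
    refine IntervalIntegrable.continuousOn_mul ?_ hKc.continuousOn
    refine (intervalIntegrable_const (c := 4 * q)).mono_fun hBm.aestronglyMeasurable ?_
    refine (ae_restrict_iff' measurableSet_uIoc).2 (Eventually.of_forall fun t ht => ?_)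
    rw [uIoc_of_le hpq] at ht
    have h1 := hB1 t (hp.trans ht.1.le)
    change ‖B t‖ ≤ ‖4 * q‖
    rw [Real.norm_of_nonneg (hB0 t), Real.norm_of_nonneg (by linarith [hp.trans ht.1.le, ht.2])]
    linarith [ht.2]
  have hneg : ∀ t, h ≤ t → t ≤ b - h → K t ≤ 0 := by
    intro t h1 h2
    have := hf.convexOn.two_mul_le_add (y := t) (h := h)
      ⟨by linarith, by linarith⟩ ⟨by linarith, by linarith⟩
    simp only [hK]; linarith
  have j1 : ∫ t in 0..h, K t * B t ≤ ∫ t in 0..h, ε * (4 * h) := by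
    refine intervalIntegral.integral_mono_on h0.le (hi _ _ le_rfl h0.le) (by simp) fun t ht => ?_
    exact mul_le_mul (hε h h0 hl1 t) (by linarith [hB1 t ht.1, ht.2]) (hB0 t) hε0.le
  have j5 : ∫ t in b - h..b, K t * B t ≤ ∫ t in b - h..b, ε * (2 * h) := by
    refine intervalIntegral.integral_mono_on (by linarith) (hi _ _ (by linarith) (by linarith))
      (by simp) fun t ht => ?_
    exact mul_le_mul (hε h h0 hl1 t)
      (by linarith [hB2 t ⟨by linarith [ht.1], ht.2⟩, ht.1]) (hB0 t) hε0.le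
  have j2 : ∫ t in h..y, K t * B t ≤ ∫ t in h..y, (0 : ℝ) :=
    intervalIntegral.integral_mono_on hl2.le (hi _ _ h0.le hl2.le) (by simp) fun t ht =>
      mul_nonpos_of_nonpos_of_nonneg (hneg t ht.1 (by linarith [ht.2])) (hB0 t)
  have j4 : ∫ t in z..b - h, K t * B t ≤ ∫ t in z..b - h, (0 : ℝ) :=
    intervalIntegral.integral_mono_on (by linarith) (hi _ _ (by linarith) (by linarith)) (by simp)
      fun t ht => mul_nonpos_of_nonpos_of_nonneg (hneg t (by linarith [ht.1]) ht.2) (hB0 t)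
  have j3 : ∫ t in y..z, K t * B t ≤ ∫ t in y..z, K t * m :=
    intervalIntegral.integral_mono_on hyz.le (hi _ _ hy.le hyz.le)
      ((by fun_prop : Continuous fun t => K t * m).intervalIntegrable _ _) fun t ht =>
        mul_le_mul_of_nonpos_left (hBw t ht)
          (hneg t (by linarith [ht.1]) (by linarith [ht.2]))
  have j6 := hwin h h0 hl0
  rw [intervalIntegral.integral_mul_const] at j3
  simp only [intervalIntegral.integral_const, smul_eq_mul, mul_zero] at j1 j2 j4 j5
  have s1 := intervalIntegral.integral_add_adjacent_intervals (hi 0 h le_rfl h0.le)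
    (hi h y h0.le hl2.le)
  have s2 := intervalIntegral.integral_add_adjacent_intervals (hi 0 y le_rfl hy.le)
    (hi y z hy.le hyz.le)
  have s3 := intervalIntegral.integral_add_adjacent_intervals (hi 0 z le_rfl (by linarith))
    (hi z (b - h) (by linarith) (by linarith))
  have s4 := intervalIntegral.integral_add_adjacent_intervals (hi 0 (b - h) le_rfl (by linarith))
    (hi (b - h) b (by linarith) (by linarith))
  have j7 : (∫ t in y..z, K t) * m ≤ -(κ * h ^ 2) * m := mul_le_mul_of_nonneg_right j6 hm.le
  have hmκ : κ * m = 7 * ε := by rw [hεdef]; ring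
  have : -(κ * h ^ 2) * m = -(7 * ε) * h ^ 2 := by rw [← hmκ]; ring
  have : 0 < ε * h ^ 2 := by positivity
  change ∫ t in 0..b, K t * B t < 0
  nlinarith

end SecondDifference

section OneSigned

/-- `φ` is a measurable function with values in `[0, 1]` vanishing off `[0, b]`. -/
structure IsUnitOn (b : ℝ) (φ : ℝ → ℝ) : Prop where
  measurable : Measurable φ
  nonneg : ∀ t, 0 ≤ φ t
  le_one : ∀ t, φ t ≤ 1
  eq_zero : ∀ t, t ∉ Icc 0 b → φ t = 0

variable {b : ℝ} {a c : ℝ → ℝ}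

theorem IsUnitOn.integrable_smul {E : Type*} [NormedAddCommGroup E] [NormedSpace ℝ E]
    (ha : IsUnitOn b a) {w : ℝ → E} (hw : Continuous w) : Integrable fun t => a t • w t := by
  have h1 : (fun t => a t • w t) = (Icc 0 b).indicator fun t => a t • w t := by
    ext t
    by_cases ht : t ∈ Icc 0 b
    · simp [ht]
    · simp [ht, ha.eq_zero t ht]
  rw [h1, integrable_indicator_iff measurableSet_Icc]
  refine Integrable.mono (hw.integrableOn_Icc (a := 0) (b := b))
    (ha.measurable.aestronglyMeasurable.smul hw.aestronglyMeasurable)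
    (Eventually.of_forall fun t => ?_)
  rw [norm_smul, Real.norm_of_nonneg (ha.nonneg t)]
  exact mul_le_of_le_one_left (norm_nonneg _) (ha.le_one t)

theorem IsUnitOn.correlation_eq_zero (ha : IsUnitOn b a) (hc : IsUnitOn b c) {y : ℝ}
    (hy : y ∉ Icc (-b) b) (s : ℝ) : a s * c (s + y) = 0 := by
  by_cases hs : s ∈ Icc 0 b
  · rw [hc.eq_zero, mul_zero]
    refine fun hs' => hy ⟨by linarith [hs.2, hs'.1], by linarith [hs.1, hs'.2]⟩
  · rw [ha.eq_zero s hs, zero_mul]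

theorem IsUnitOn.measurable_correlation (ha : IsUnitOn b a) (hc : IsUnitOn b c) :
    Measurable fun y => ∫ s, a s * c (s + y) := by
  have : Measurable fun p : ℝ × ℝ => a p.2 * c (p.2 + p.1) :=
    (ha.measurable.comp measurable_snd).mul
      (hc.measurable.comp (measurable_snd.add measurable_fst))
  exact (this.stronglyMeasurable.integral_prod_right' (ν := volume)).measurable

theorem IsUnitOn.integrable_correlation_integrand (ha : IsUnitOn b a) (hc : IsUnitOn b c) (y : ℝ) :
    Integrable fun s => a s * c (s + y) := by
  refine (ha.integrable_smul (w := fun _ => (1 : ℝ)) continuous_const).mono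
    (ha.measurable.mul (hc.measurable.comp (measurable_add_const y))).aestronglyMeasurable
    (Eventually.of_forall fun s => ?_)
  simp only [smul_eq_mul, mul_one, norm_mul]
  refine mul_le_of_le_one_right (norm_nonneg _) ?_
  rw [Real.norm_of_nonneg (hc.nonneg _)]
  exact hc.le_one _

/-- A double integral against a difference kernel, as a single integral against the symmetrized
correlation of the two densities. -/
theorem IsUnitOn.integral_integral_even (ha : IsUnitOn b a) (hc : IsUnitOn b c) (hb : 0 ≤ b)
    {K : ℝ → ℝ} (hK : Continuous K) (heven : ∀ y, K (-y) = K y) :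
    ∫ s, ∫ t, a s * (c t * K (t - s))
      = ∫ y in 0..b, K y * ((∫ s, a s * c (s + y)) + ∫ s, a s * c (s + -y)) := by
  set A : ℝ → ℝ := fun y => ∫ s, a s * c (s + y) with hA
  have hA0 : ∀ y, y ∉ Icc (-b) b → A y = 0 := fun y hy => by
    simp only [hA, ha.correlation_eq_zero hc hy, integral_zero]
  have h1 : ∀ s, ∫ t, a s * (c t * K (t - s)) = ∫ y, a s * c (s + y) * K y := by
    intro s
    rw [← integral_add_left_eq_self _ s]
    simp only [add_sub_cancel_left, mul_assoc]
  simp_rw [h1]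
  have hint : Integrable (Function.uncurry fun s y => a s * c (s + y) * K y)
      (volume.prod volume) := by
    obtain ⟨C, hC⟩ := isCompact_Icc.exists_bound_of_continuousOn (s := Icc (-b) b) hK.continuousOn
    have hm : Measurable (Function.uncurry fun s y => a s * c (s + y) * K y) :=
      ((ha.measurable.comp measurable_fst).mul
        (hc.measurable.comp (measurable_fst.add measurable_snd))).mul
        (hK.measurable.comp measurable_snd)
    have h2 : (Function.uncurry fun s y => a s * c (s + y) * K y)
        = (Icc 0 b ×ˢ Icc (-b) b).indicator
          (Function.uncurry fun s y => a s * c (s + y) * K y) := by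
      ext ⟨s, y⟩
      by_cases hs : s ∈ Icc 0 b
      · by_cases hy : y ∈ Icc (-b) b
        · rw [indicator_of_mem (by exact ⟨hs, hy⟩)]
        · rw [indicator_of_notMem (by exact fun h => hy h.2)]
          simp [ha.correlation_eq_zero hc hy]
      · rw [indicator_of_notMem (by exact fun h => hs h.1)]
        simp [ha.eq_zero s hs]
    rw [h2, integrable_indicator_iff (measurableSet_Icc.prod measurableSet_Icc)]
    have hfin : (volume.prod volume : Measure (ℝ × ℝ)) (Icc 0 b ×ˢ Icc (-b) b) < ⊤ :=
      (isCompact_Icc.prod isCompact_Icc).measure_lt_top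
    refine Measure.integrableOn_of_bounded (M := C) hfin.ne hm.aestronglyMeasurable ?_
    refine (ae_restrict_iff' (measurableSet_Icc.prod measurableSet_Icc)).2
      (Eventually.of_forall fun p hp => ?_)
    have h3 := hC p.2 hp.2
    simp only [Function.uncurry, norm_mul, Real.norm_of_nonneg (ha.nonneg _),
      Real.norm_of_nonneg (hc.nonneg _)]
    refine le_trans (mul_le_of_le_one_left (norm_nonneg _) ?_) h3
    exact mul_le_one₀ (ha.le_one _) (hc.nonneg _) (hc.le_one _)
  rw [integral_integral_swap hint]
  have hAK : Integrable fun y => A y * K y := by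
    have := hint.integral_prod_right
    simpa only [Function.uncurry, integral_mul_const] using this
  simp_rw [integral_mul_const]
  change ∫ y, A y * K y = ∫ y in 0..b, K y * (A y + A (-y))
  have h4 : ∫ y, A y * K y = ∫ y in -b..b, A y * K y := by
    rw [intervalIntegral.integral_of_le (by linarith), ← integral_Icc_eq_integral_Ioc,
      setIntegral_eq_integral_of_forall_compl_eq_zero]
    intro y hy
    rw [hA0 y hy, zero_mul]
  have hii : ∀ p q, IntervalIntegrable (fun y => A y * K y) volume p q := fun p q =>
    hAK.intervalIntegrable
  have hii' : IntervalIntegrable (fun y => A (-y) * K y) volume 0 b := by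
    have := hAK.comp_neg.intervalIntegrable (a := 0) (b := b)
    simpa only [heven] using this
  have h5 : ∫ y in -b..0, A y * K y = ∫ y in 0..b, A (-y) * K y := by
    have := intervalIntegral.integral_comp_neg (a := 0) (b := b) fun y => A y * K y
    simpa only [heven, neg_zero] using this.symm
  rw [h4, ← intervalIntegral.integral_add_adjacent_intervals (hii (-b) 0) (hii 0 b), h5,
    ← intervalIntegral.integral_add hii' (hii 0 b)]
  congr 1; ext y; ring

theorem IsUnitOn.inner_integral_smul {H : Type*} [NormedAddCommGroup H] [InnerProductSpace ℝ H]
    [CompleteSpace H] (ha : IsUnitOn b a) {w : ℝ → H} (hw : Continuous w) (z : H) :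
    inner ℝ z (∫ t, a t • w t) = ∫ t, a t * inner ℝ z (w t) := by
  rw [← integral_inner (ha.integrable_smul hw)]
  simp_rw [inner_smul_right]

/-- If `a - c` has constant potential, then the second difference form of `a` and `c` is
nonnegative. -/
theorem IsStatCurve.integral_second_difference_correlation_nonneg {H : Type*}
    [NormedAddCommGroup H] [InnerProductSpace ℝ H] [CompleteSpace H] {R : ℝ → ℝ} {x : ℝ → H}
    (hx : IsStatCurve R x) (ha : IsUnitOn b a) (hc : IsUnitOn b c) (hb : 0 ≤ b) {C : ℝ}
    (hR : Continuous R) (hpot : ∀ s, ∫ t, (a t - c t) * R (t - s) = C) (h : ℝ) :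
    0 ≤ ∫ y in 0..b, (2 * R y - R (y + h) - R (y - h))
      * ((∫ s, a s * c (s + y)) + ∫ s, a s * c (s + -y)) := by
  set w : ℝ → H := fun t => x (t + h) - x t with hw
  have hxc := hx.continuous
  have hwc : Continuous w := by fun_prop
  have hinner : ∀ s t, inner ℝ (w s) (w t)
      = 2 * R (t - s) - R (t - s + h) - R (t - s - h) := by
    intro s t
    simp only [hw, inner_sub_left, inner_sub_right, hx.inner_eq]
    rw [show t + h - (s + h) = t - s by ring, show t + h - s = t - s + h by ring,
      show t - (s + h) = t - s - h by ring]
    ring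
  have hi : ∀ {φ : ℝ → ℝ}, IsUnitOn b φ → ∀ s, Integrable fun t => φ t * R (t - s) :=
    fun hφ s => by
      simpa using hφ.integrable_smul (w := fun t => R (t - s)) (by fun_prop)
  have hpot' : ∀ s, (∫ t, a t * R (t - s)) - ∫ t, c t * R (t - s) = C := by
    intro s
    rw [← hpot s, ← integral_sub (hi ha s) (hi hc s)]
    simp_rw [sub_mul]
  have hxw : ∀ {φ : ℝ → ℝ}, IsUnitOn b φ → ∀ s, inner ℝ (x s) (∫ t, φ t • w t)
      = (∫ t, φ t * R (t - (s - h))) - ∫ t, φ t * R (t - s) := by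
    intro φ hφ s
    rw [hφ.inner_integral_smul hwc, ← integral_sub (hi hφ _) (hi hφ _)]
    congr 1; ext t
    simp only [hw, inner_sub_right, hx.inner_eq]
    rw [show t - (s - h) = t + h - s by ring]
    ring
  set va := ∫ t, a t • w t with hva
  set vc := ∫ t, c t • w t with hvc
  have h0 : ∀ s, inner ℝ (x s) (va - vc) = 0 := by
    intro s
    rw [inner_sub_right, hxw ha, hxw hc]
    linarith [hpot' s, hpot' (s - h)]
  have h1 : ∀ t, inner ℝ (va - vc) (w t) = 0 := by
    intro t
    rw [real_inner_comm, hw, inner_sub_left, h0, h0, sub_zero]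
  have h2 : va - vc = 0 := by
    rw [← inner_self_eq_zero (𝕜 := ℝ)]
    nth_rewrite 2 [hva]
    nth_rewrite 2 [hvc]
    rw [inner_sub_right, ha.inner_integral_smul hwc, hc.inner_integral_smul hwc]
    simp [h1]
  have h3 : inner ℝ vc va = ∫ s, ∫ t, a s * (c t * (2 * R (t - s) - R (t - s + h)
      - R (t - s - h))) := by
    rw [hva, ha.inner_integral_smul hwc]
    congr 1; ext s
    rw [integral_const_mul, real_inner_comm, hvc, hc.inner_integral_smul hwc]
    simp_rw [hinner]
  have heven := hx.even
  rw [← ha.integral_integral_even hc hb (K := fun y => 2 * R y - R (y + h) - R (y - h))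
    (by fun_prop) ?_, ← h3, ← sub_eq_zero.1 h2]
  · exact real_inner_self_nonneg
  · intro y
    rw [heven, show -y + h = -(y - h) by ring, show -y - h = -(y + h) by ring, heven, heven]
    ring

end OneSigned

section Sign

variable {b : ℝ} {ν ν₁ ν₂ : Measure ℝ}

theorem IsProbOn.cdf_eq_cdf_of_notMem (h₁ : IsProbOn b ν₁) (h₂ : IsProbOn b ν₂) {t : ℝ}
    (ht : t ∉ Ico 0 b) : cdf ν₁ t = cdf ν₂ t := by
  rcases lt_or_ge t 0 with h | h
  · rw [h₁.cdf_eq_zero h, h₂.cdf_eq_zero h]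
  · have : b ≤ t := not_lt.1 fun h' => ht ⟨h, h'⟩
    rw [h₁.cdf_eq_one this, h₂.cdf_eq_one this]

theorem IsProbOn.isUnitOn_cdf_sub_max (h₁ : IsProbOn b ν₁) (h₂ : IsProbOn b ν₂) :
    IsUnitOn b fun t => max (cdf ν₁ t - cdf ν₂ t) 0 where
  measurable := ((monotone_cdf ν₁).measurable.sub (monotone_cdf ν₂).measurable).max
    measurable_const
  nonneg _ := le_max_right _ _
  le_one t := max_le (by linarith [cdf_le_one ν₁ t, cdf_nonneg ν₂ t]) zero_le_one
  eq_zero t ht := by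
    rw [h₁.cdf_eq_cdf_of_notMem h₂ fun h => ht ⟨h.1, h.2.le⟩, sub_self, max_self]

theorem exists_forall_Icc_lt_cdf_sub {p r : ℝ} (hr : r < cdf ν₁ p - cdf ν₂ p) :
    ∃ δ > 0, ∀ t ∈ Icc p (p + δ), r < cdf ν₁ t - cdf ν₂ t := by
  have hcont : ContinuousWithinAt (fun t => cdf ν₁ t - cdf ν₂ t) (Ici p) p :=
    ((cdf ν₁).right_continuous p).sub ((cdf ν₂).right_continuous p)
  obtain ⟨z, hz, hz'⟩ := mem_nhdsGE_iff_exists_Icc_subset.1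
    (hcont.eventually (lt_mem_nhds hr))
  exact ⟨z - p, sub_pos.2 hz, fun t ht => hz' ⟨ht.1, by linarith [ht.2]⟩⟩

theorem max_sub_mul_max_sub_le {f g : ℝ → ℝ} (hf : Monotone f) (hg : Monotone g)
    (hf1 : ∀ t, f t ≤ 1) (hg0 : ∀ t, 0 ≤ g t) {s t : ℝ} (hst : s ≤ t) :
    max (f s - g s) 0 * max (g t - f t) 0 ≤ g t - g s := by
  have h1 := hf hst
  have h2 := hg hst
  rcases le_total (f s) (g s) with h | h
  · rw [max_eq_right (by linarith), zero_mul]; linarith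
  · rcases le_total (g t) (f t) with h' | h'
    · rw [max_eq_right (by linarith : g t - f t ≤ 0), mul_zero]; linarith
    · rw [max_eq_left (by linarith), max_eq_left (by linarith)]
      nlinarith [hf1 s, hg0 s]

variable {H : Type*} [NormedAddCommGroup H] [InnerProductSpace ℝ H] {R : ℝ → ℝ} {x : ℝ → H}

theorem IsStatCurve.second_difference_le (hx : IsStatCurve R x) (h t : ℝ) :
    2 * R t - R (t + h) - R (t - h) ≤ 2 * (R 0 - R h) := by
  have hn : ∀ s, ‖x (s + h) - x s‖ ^ 2 = 2 * (R 0 - R h) := by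
    intro s
    rw [norm_sub_sq_real, ← real_inner_self_eq_norm_sq, ← real_inner_self_eq_norm_sq,
      hx.inner_eq, hx.inner_eq, hx.inner_eq, sub_self, sub_self,
      show s - (s + h) = -h by ring, hx.even]
    ring
  have h1 := real_inner_le_norm (x (0 + h) - x 0) (x (t + h) - x t)
  have h2 : inner ℝ (x (0 + h) - x 0) (x (t + h) - x t)
      = 2 * R t - R (t + h) - R (t - h) := by
    simp only [inner_sub_left, inner_sub_right, hx.inner_eq]
    rw [show t + h - (0 + h) = t by ring, show t - (0 + h) = t - h by ring, sub_zero, sub_zero]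
    ring
  nlinarith [hn 0, hn t, sq_nonneg (‖x (0 + h) - x 0‖ - ‖x (t + h) - x t‖)]

/-- The distribution functions of two measures with the same potential do not cross. -/
theorem IsStatCurve.not_cdf_crossing [CompleteSpace H] (hx : IsStatCurve R x) (hR : Continuous R)
    (hb : 0 < b) (hconv : StrictConvexOn ℝ (Icc 0 b) R) (h₁ : IsProbOn b ν₁) (h₂ : IsProbOn b ν₂)
    (hnull : ∀ t, ∫ s, R (s - t) ∂ν₁ = ∫ s, R (s - t) ∂ν₂) {p q : ℝ} (hpq : p < q)
    (hp : cdf ν₂ p < cdf ν₁ p) (hq : cdf ν₁ q < cdf ν₂ q) : False := by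
  set a : ℝ → ℝ := fun t => max (cdf ν₁ t - cdf ν₂ t) 0 with ha'
  set c : ℝ → ℝ := fun t => max (cdf ν₂ t - cdf ν₁ t) 0 with hc'
  have ha : IsUnitOn b a := h₁.isUnitOn_cdf_sub_max h₂
  have hc : IsUnitOn b c := h₂.isUnitOn_cdf_sub_max h₁
  have hac : ∀ t, a t - c t = cdf ν₁ t - cdf ν₂ t := by
    intro t
    simp only [ha', hc']
    rw [← neg_sub (cdf ν₁ t) (cdf ν₂ t)]
    exact max_zero_sub_max_neg_zero_eq_self _
  have hpot : ∀ s, ∫ t, (a t - c t) * R (t - s)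
      = ∫ t in 0..b, (cdf ν₁ t - cdf ν₂ t) * R t := by
    intro s
    rw [← h₁.integral_cdf_sub_mul_kernel h₂ hb.le hR hnull s,
      intervalIntegral.integral_of_le hb.le, ← integral_Icc_eq_integral_Ioc,
      setIntegral_eq_integral_of_forall_compl_eq_zero]
    · simp_rw [hac]
    · intro t ht
      rw [h₁.cdf_eq_cdf_of_notMem h₂ fun h => ht ⟨h.1, h.2.le⟩, sub_self, zero_mul]
  set A : ℝ → ℝ := fun y => ∫ s, a s * c (s + y) with hA
  have hA0 : ∀ y, 0 ≤ A y := fun y =>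
    integral_nonneg fun s => mul_nonneg (ha.nonneg s) (hc.nonneg _)
  have hAI : ∀ y, A y = ∫ s in 0..b, a s * c (s + y) := by
    intro y
    rw [intervalIntegral.integral_of_le hb.le, ← integral_Icc_eq_integral_Ioc,
      setIntegral_eq_integral_of_forall_compl_eq_zero]
    intro s hs
    rw [ha.eq_zero s hs, zero_mul]
  have hAi : ∀ y p q, IntervalIntegrable (fun s => a s * c (s + y)) volume p q := fun y p q =>
    (ha.integrable_correlation_integrand hc y).intervalIntegrable
  have hinc : ∀ (ν : Measure ℝ) (y p q : ℝ),
      IntervalIntegrable (fun s => cdf ν (s + y)) volume p q := fun ν y p q =>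
    Monotone.intervalIntegrable fun _ _ h => monotone_cdf ν (by linarith)
  have hA1 : ∀ y, 0 ≤ y → A y ≤ y := by
    intro y hy
    have h := integral_cdf_shift_le ν₂ b hy 0
    rw [zero_add] at h
    refine le_trans ?_ h
    rw [hAI]
    refine intervalIntegral.integral_mono_on hb.le (hAi _ _ _)
      ((hinc _ _ _ _).sub (intervalIntegrable_cdf _ _ _)) fun s _ => ?_
    exact max_sub_mul_max_sub_le (monotone_cdf ν₁) (monotone_cdf ν₂) (cdf_le_one ν₁)
      (cdf_nonneg ν₂) (by linarith)
  have hA2 : ∀ y, 0 ≤ y → A (-y) ≤ y := by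
    intro y hy
    have h := integral_cdf_shift_le ν₁ b hy (-y)
    refine le_trans ?_ h
    have h' := intervalIntegral.integral_comp_sub_right (a := 0) (b := b)
      (fun t => cdf ν₁ (t + y) - cdf ν₁ t) y
    rw [zero_sub, sub_eq_neg_add] at h'
    rw [← h', hAI]
    refine intervalIntegral.integral_mono_on hb.le (hAi _ _ _) ?_ fun s _ => ?_
    · simp only [sub_add_cancel]
      exact (intervalIntegrable_cdf _ _ _).sub (hinc _ (-y) _ _)
    · simp only [sub_add_cancel]
      rw [mul_comm]
      exact max_sub_mul_max_sub_le (monotone_cdf ν₂) (monotone_cdf ν₁) (cdf_le_one ν₂)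
        (cdf_nonneg ν₁) (by linarith)
  have hA3 : ∀ y d e, d ≤ e → (∀ s, s ∉ Icc d e → a s * c (s + y) = 0) → A y ≤ e - d := by
    intro y d e hde h0
    have h : A y = ∫ s in d..e, a s * c (s + y) := by
      rw [intervalIntegral.integral_of_le hde, ← integral_Icc_eq_integral_Ioc,
        setIntegral_eq_integral_of_forall_compl_eq_zero h0]
    have h' : ∫ s in d..e, a s * c (s + y) ≤ ∫ s in d..e, (1 : ℝ) :=
      intervalIntegral.integral_mono_on hde (hAi _ _ _) (by simp) fun s _ =>
        mul_le_one₀ (ha.le_one s) (hc.nonneg _) (hc.le_one _)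
    simp only [intervalIntegral.integral_const, smul_eq_mul, mul_one] at h'
    linarith
  set η := min ((cdf ν₁ p - cdf ν₂ p) / 2) ((cdf ν₂ q - cdf ν₁ q) / 2)
  have hη : 0 < η := lt_min (by linarith) (by linarith)
  obtain ⟨δ₁, hδ₁, hu₁⟩ := exists_forall_Icc_lt_cdf_sub (r := η) (p := p) (ν₁ := ν₁) (ν₂ := ν₂)
    ((min_le_left _ _).trans_lt (by linarith))
  obtain ⟨δ₂, hδ₂, hu₂⟩ := exists_forall_Icc_lt_cdf_sub (r := η) (p := q) (ν₁ := ν₂) (ν₂ := ν₁)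
    ((min_le_right _ _).trans_lt (by linarith))
  have hp0 : 0 ≤ p := by
    by_contra hp0
    rw [h₁.cdf_eq_cdf_of_notMem h₂ fun h => hp0 h.1] at hp
    exact lt_irrefl _ hp
  set δ := min δ₁ δ₂
  have hδ : 0 < δ := lt_min hδ₁ hδ₂
  have hδ1 : δ ≤ δ₁ := min_le_left _ _
  have hδ2 : δ ≤ δ₂ := min_le_right _ _
  have hqb : q + δ < b := by
    by_contra hqb
    have := hu₂ (q + δ) ⟨by linarith, by linarith⟩
    rw [h₂.cdf_eq_cdf_of_notMem h₁ fun h => hqb h.2] at this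
    linarith
  have hwin : ∀ y ∈ Icc (q - p) (q - p + δ / 2), δ / 2 * (η * η) ≤ A y := by
    intro y hy
    have h1 : ∫ s in p..p + δ / 2, η * η ≤ ∫ s in p..p + δ / 2, a s * c (s + y) := by
      refine intervalIntegral.integral_mono_on (by linarith) (by simp) (hAi _ _ _) fun s hs => ?_
      refine mul_le_mul ?_ ?_ hη.le (ha.nonneg s)
      · exact (hu₁ s ⟨hs.1, by linarith [hs.2]⟩).le.trans (le_max_left _ _)
      · exact (hu₂ (s + y) ⟨by linarith [hs.1, hy.1], by linarith [hs.2, hy.2]⟩).le.trans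
          (le_max_left _ _)
    have h2 : ∫ s in p..p + δ / 2, a s * c (s + y) ≤ A y := by
      rw [intervalIntegral.integral_of_le (by linarith)]
      exact setIntegral_le_integral (ha.integrable_correlation_integrand hc y)
        (Eventually.of_forall fun s => mul_nonneg (ha.nonneg s) (hc.nonneg _))
    simp only [intervalIntegral.integral_const, smul_eq_mul, add_sub_cancel_left] at h1
    exact h1.trans h2
  have hsmall : ∀ ε > 0, ∃ h₀ > 0, ∀ h, 0 < h → h < h₀ →
      ∀ t, 2 * R t - R (t + h) - R (t - h) ≤ ε := by
    intro ε hε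
    obtain ⟨h₀, hh₀, hh⟩ := Metric.continuous_iff.1 hR 0 (ε / 2) (by linarith)
    refine ⟨h₀, hh₀, fun h h0 h1 t => (hx.second_difference_le h t).trans ?_⟩
    have := hh h (by rwa [Real.dist_eq, sub_zero, abs_of_pos h0])
    rw [Real.dist_eq] at this
    linarith [(abs_lt.1 this).1]
  have hAm : Measurable A := ha.measurable_correlation hc
  have hB2 : ∀ t ∈ Icc 0 b, A t + A (-t) ≤ 2 * (b - t) := by
    intro t ht
    have e1 := hA3 t 0 (b - t) (by linarith [ht.2]) fun s hs => by
      by_cases h0 : 0 ≤ s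
      · rw [hc.eq_zero (s + t), mul_zero]
        exact fun h => hs ⟨h0, by linarith [h.2]⟩
      · rw [ha.eq_zero s fun h => h0 h.1, zero_mul]
    have e2 := hA3 (-t) t b ht.2 fun s hs => by
      by_cases h0 : s ≤ b
      · rw [hc.eq_zero (s + -t), mul_zero]
        exact fun h => hs ⟨by linarith [h.1], h0⟩
      · rw [ha.eq_zero s fun h => h0 h.2, zero_mul]
    linarith
  obtain ⟨h, hneg⟩ := hconv.exists_integral_second_difference_mul_neg
    (B := fun y => A y + A (-y)) (y := q - p) (z := q - p + δ / 2) (m := δ / 2 * (η * η))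
    hR hsmall (by linarith) (by linarith) (by linarith) (hAm.add (hAm.comp measurable_neg))
    (fun t => add_nonneg (hA0 _) (hA0 _)) (fun t ht => by linarith [hA1 t ht, hA2 t ht])
    hB2 (by positivity) (fun t ht => by linarith [hwin t ht, hA0 (-t)])
  exact absurd (hx.integral_second_difference_correlation_nonneg ha hc hb.le hR hpot h)
    (not_le.2 hneg)

end Sign

section Uniqueness

variable {b : ℝ} {ν ν₁ ν₂ : Measure ℝ}

theorem IsUnitOn.integral_mul_eq {a : ℝ → ℝ} (ha : IsUnitOn b a) (hb : 0 ≤ b) (g : ℝ → ℝ) :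
    ∫ t, a t * g t = ∫ t in 0..b, a t * g t := by
  rw [intervalIntegral.integral_of_le hb, ← integral_Icc_eq_integral_Ioc,
    setIntegral_eq_integral_of_forall_compl_eq_zero]
  intro t ht
  rw [ha.eq_zero t ht, zero_mul]

theorem IsUnitOn.integral_withDensity {a : ℝ → ℝ} (ha : IsUnitOn b a) {I : ℝ} (hI : 0 < I)
    (g : ℝ → ℝ) :
    ∫ t, g t ∂(volume.withDensity fun t => ENNReal.ofReal (a t / I)) = (∫ t, a t * g t) / I := by
  rw [integral_withDensity_eq_integral_toReal_smul (ha.measurable.div_const I).ennreal_ofReal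
    (Eventually.of_forall fun _ => ENNReal.ofReal_lt_top), ← integral_div]
  congr 1; ext t
  rw [ENNReal.toReal_ofReal (div_nonneg (ha.nonneg t) hI.le), smul_eq_mul]
  ring

theorem IsUnitOn.isProbOn_withDensity {a : ℝ → ℝ} (ha : IsUnitOn b a) (hI : 0 < ∫ t, a t) :
    IsProbOn b (volume.withDensity fun t => ENNReal.ofReal (a t / ∫ t, a t)) := by
  have hint : Integrable a := by
    simpa using ha.integrable_smul (w := fun _ => (1 : ℝ)) continuous_const
  refine ⟨⟨?_⟩, ?_⟩
  · rw [withDensity_apply _ MeasurableSet.univ, Measure.restrict_univ,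
      ← ofReal_integral_eq_lintegral_ofReal (hint.div_const _)
        (Eventually.of_forall fun t => div_nonneg (ha.nonneg t) hI.le), integral_div,
      div_self hI.ne', ENNReal.ofReal_one]
  · rw [withDensity_apply _ measurableSet_Icc.compl]
    refine setLIntegral_eq_zero measurableSet_Icc.compl fun t ht => ?_
    simp [ha.eq_zero t ht]

theorem IsProbOn.eq_of_cdf_le (h₁ : IsProbOn b ν₁) (h₂ : IsProbOn b ν₂) (hb : 0 ≤ b)
    (hle : ∀ t, cdf ν₁ t ≤ cdf ν₂ t) (hmean : ∫ r, r ∂ν₁ = ∫ r, r ∂ν₂) : ν₁ = ν₂ := by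
  have := h₁.prob
  have := h₂.prob
  refine Measure.eq_of_cdf _ _ (StieltjesFunction.ext fun t => ?_)
  by_contra hne
  have hlt := lt_of_le_of_ne (hle t) hne
  obtain ⟨r, hr0, hr⟩ := exists_between (sub_pos.2 hlt)
  obtain ⟨δ, hδ, hu⟩ := exists_forall_Icc_lt_cdf_sub hr
  have h0 : 0 ≤ t := by
    by_contra h0
    exact hne (h₁.cdf_eq_cdf_of_notMem h₂ fun h => h0 h.1)
  have hδb : t + δ < b := by
    by_contra hδb
    have := hu (t + δ) ⟨by linarith, le_rfl⟩
    rw [h₁.cdf_eq_cdf_of_notMem h₂ fun h => hδb h.2] at this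
    linarith
  have hii : ∀ p q, IntervalIntegrable (fun t => cdf ν₂ t - cdf ν₁ t) volume p q := fun p q =>
    (intervalIntegrable_cdf _ _ _).sub (intervalIntegrable_cdf _ _ _)
  have e0 : ∫ t in 0..b, (cdf ν₂ t - cdf ν₁ t) = 0 := by
    rw [intervalIntegral.integral_sub (intervalIntegrable_cdf _ _ _) (intervalIntegrable_cdf _ _ _),
      h₁.integral_cdf hb, h₂.integral_cdf hb, hmean, sub_self]
  have e1 : ∫ s in t..t + δ, r ≤ ∫ s in t..t + δ, (cdf ν₂ s - cdf ν₁ s) :=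
    intervalIntegral.integral_mono_on (by linarith) (by simp) (hii _ _) fun s hs => (hu s hs).le
  have e2 := intervalIntegral.integral_mono_interval (μ := volume) h0
    (by linarith : t ≤ t + δ) hδb.le
    (Eventually.of_forall fun s => sub_nonneg.2 (hle s)) (hii 0 b)
  simp only [intervalIntegral.integral_const, smul_eq_mul, add_sub_cancel_left] at e1
  nlinarith

variable {H : Type*} [NormedAddCommGroup H] [InnerProductSpace ℝ H] [CompleteSpace H]
  {R : ℝ → ℝ} {x : ℝ → H}

namespace IsStatCurve

theorem cdf_le_or_le (hx : IsStatCurve R x) (hR : Continuous R)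
    (hb : 0 < b) (hconv : StrictConvexOn ℝ (Icc 0 b) R) (h₁ : IsOptimal R b ν₁)
    (h₂ : IsOptimal R b ν₂) :
    (∀ t, cdf ν₁ t ≤ cdf ν₂ t) ∨ ∀ t, cdf ν₂ t ≤ cdf ν₁ t := by
  by_contra! h
  obtain ⟨⟨p, hp⟩, q, hq⟩ := h
  rcases lt_trichotomy p q with hpq | rfl | hpq
  · exact hx.not_cdf_crossing hR hb hconv h₁.toIsProbOn h₂.toIsProbOn
      (hx.potential_eq_of_isOptimal h₁ h₂) hpq hp hq
  · exact lt_asymm hp hq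
  · exact hx.not_cdf_crossing hR hb hconv h₂.toIsProbOn h₁.toIsProbOn
      (hx.potential_eq_of_isOptimal h₂ h₁) hpq hq hp

theorem eq_of_integral_eq (hx : IsStatCurve R x) (hR : Continuous R)
    (hb : 0 < b) (hconv : StrictConvexOn ℝ (Icc 0 b) R) (h₁ : IsOptimal R b ν₁)
    (h₂ : IsOptimal R b ν₂) (hmean : ∫ r, r ∂ν₁ = ∫ r, r ∂ν₂) : ν₁ = ν₂ := by
  rcases hx.cdf_le_or_le hR hb hconv h₁ h₂ with h | h
  · exact h₁.toIsProbOn.eq_of_cdf_le h₂.toIsProbOn hb.le h hmean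
  · exact (h₂.toIsProbOn.eq_of_cdf_le h₁.toIsProbOn hb.le h hmean.symm).symm

/-- Two optimal measures whose distribution functions are ordered, and which have the first two
moments of mirror images, coincide. -/
theorem eq_of_cdf_le_of_moments (hx : IsStatCurve R x) (hR : Continuous R)
    (hb : 0 < b) (hconv : StrictConvexOn ℝ (Icc 0 b) R) (h₁ : IsOptimal R b ν₁)
    (h₂ : IsOptimal R b ν₂) (hle : ∀ t, cdf ν₂ t ≤ cdf ν₁ t)
    (hm : (∫ r, r ∂ν₁) + ∫ r, r ∂ν₂ = b)
    (hsq : (∫ r, r ^ 2 ∂ν₂) - ∫ r, r ^ 2 ∂ν₁ = b * ((∫ r, r ∂ν₂) - ∫ r, r ∂ν₁)) :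
    ν₁ = ν₂ := by
  have := h₁.prob
  have := h₂.prob
  set a : ℝ → ℝ := fun t => max (cdf ν₁ t - cdf ν₂ t) 0
  have ha : IsUnitOn b a := h₁.toIsProbOn.isUnitOn_cdf_sub_max h₂.toIsProbOn
  have hau : ∀ t, a t = cdf ν₁ t - cdf ν₂ t := fun t => max_eq_left (sub_nonneg.2 (hle t))
  have hc : ∀ ν : Measure ℝ, IntervalIntegrable (fun t => cdf ν t * t) volume 0 b := fun ν =>
    (intervalIntegrable_cdf ν 0 b).mul_continuousOn continuousOn_id
  have hIm : ∫ t, a t = (∫ r, r ∂ν₂) - ∫ r, r ∂ν₁ := by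
    have := ha.integral_mul_eq hb.le fun _ => 1
    simp only [mul_one] at this
    rw [this]
    simp_rw [hau]
    rw [intervalIntegral.integral_sub (intervalIntegrable_cdf _ _ _) (intervalIntegrable_cdf _ _ _),
      h₁.toIsProbOn.integral_cdf hb.le, h₂.toIsProbOn.integral_cdf hb.le]
    ring
  have hI0 : 0 ≤ ∫ t, a t := integral_nonneg ha.nonneg
  rcases hI0.eq_or_lt with hI | hI
  · exact (h₂.toIsProbOn.eq_of_cdf_le h₁.toIsProbOn hb.le hle (by linarith)).symm
  exfalso
  have hw := ha.isProbOn_withDensity hI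
  have hwint := ha.integral_withDensity hI
  set I := ∫ t, a t
  set w := volume.withDensity fun t => ENNReal.ofReal (a t / I)
  have := hw.prob
  have hwo : IsOptimal R b w := by
    refine hx.isOptimal_of_potential_eq hw
      (C := (∫ t in 0..b, (cdf ν₁ t - cdf ν₂ t) * R t) / I) fun t _ => ?_
    rw [hwint, ha.integral_mul_eq hb.le]
    simp_rw [hau]
    rw [h₁.toIsProbOn.integral_cdf_sub_mul_kernel h₂.toIsProbOn hb.le hR
      (hx.potential_eq_of_isOptimal h₁ h₂)]
  have hmom : ∀ ν, IsProbOn b ν →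
      ∫ t in 0..b, cdf ν t * t = (b ^ 2 - ∫ r, r ^ 2 ∂ν) / 2 := by
    intro ν hν
    have := hν.prob
    rw [hν.integral_cdf_mul hb.le continuous_id']
    simp only [integral_id]
    rw [integral_div, integral_sub (integrable_const _) (hν.integrable (by fun_prop))]
    simp
  have hwm : ∫ r, r ∂w = b / 2 := by
    rw [hwint, ha.integral_mul_eq hb.le, div_eq_iff hI.ne']
    simp_rw [hau, sub_mul]
    rw [intervalIntegral.integral_sub (hc _) (hc _), hmom ν₁ h₁.toIsProbOn, hmom ν₂ h₂.toIsProbOn,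
      hIm]
    linarith
  have hl : (1 / 2 : ℝ) ∈ Icc (0 : ℝ) 1 := by norm_num
  have hmix := hx.isOptimal_mix h₁ h₂ hl
  have hmm : ∫ r, r ∂(ENNReal.ofReal (1 / 2) • ν₁ + ENNReal.ofReal (1 - 1 / 2) • ν₂) = b / 2 := by
    rw [integral_add_measure ((h₁.integrable continuous_id').smul_measure (by simp))
      ((h₂.integrable continuous_id').smul_measure (by simp)), integral_smul_measure,
      integral_smul_measure, ENNReal.toReal_ofReal (by norm_num),
      ENNReal.toReal_ofReal (by norm_num), smul_eq_mul, smul_eq_mul]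
    linarith
  have heq := hx.eq_of_integral_eq hR hb hconv hmix hwo (hmm.trans hwm.symm)
  set W : ℝ → ℝ := fun t => ∫ s in 0..t, a s
  have haii : ∀ p q, IntervalIntegrable a volume p q := fun p q => by
    have := (ha.integrable_smul (w := fun _ => (1 : ℝ)) continuous_const).intervalIntegrable
      (a := p) (b := q)
    simpa using this
  have hWc : Continuous W := intervalIntegral.continuous_primitive haii 0
  have hW0 : ∀ t, 0 ≤ t → 0 ≤ W t := fun t ht =>
    intervalIntegral.integral_nonneg ht fun s _ => ha.nonneg s
  have hcdfw : ∀ t, 0 ≤ t → w.real (Iic t) = W t / I := by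
    intro t ht
    have h1 := hwint ((Iic t).indicator 1)
    rw [integral_indicator_one measurableSet_Iic] at h1
    rw [h1]
    congr 1
    have h2 : ∀ s, a s * (Iic t).indicator 1 s = (Icc 0 t).indicator a s := by
      intro s
      by_cases h0 : 0 ≤ s
      · by_cases h1 : s ≤ t <;> simp [h0, h1]
      · have : a s = 0 := ha.eq_zero s fun h => h0 h.1
        simp [indicator_apply, h0, this]
    simp_rw [h2]
    rw [integral_indicator measurableSet_Icc, integral_Icc_eq_integral_Ioc,
      ← intervalIntegral.integral_of_le ht]
  have hbound : ∀ t, 0 ≤ t → a t ≤ 2 / I * W t := by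
    intro t ht
    have h1 := hcdfw t ht
    have hfin : ∀ (c : ℝ) (κ : Measure ℝ) [IsProbabilityMeasure κ],
        (ENNReal.ofReal c • κ) (Iic t) ≠ ⊤ := fun c κ _ => by
      rw [Measure.smul_apply, smul_eq_mul]
      exact ENNReal.mul_ne_top ENNReal.ofReal_ne_top (measure_ne_top _ _)
    rw [← heq, measureReal_add_apply (hfin _ _) (hfin _ _), measureReal_ennreal_smul_apply,
      measureReal_ennreal_smul_apply, ENNReal.toReal_ofReal (by norm_num),
      ENNReal.toReal_ofReal (by norm_num), ← cdf_eq_real, ← cdf_eq_real] at h1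
    have h2 : 2 / I * W t = 2 * (W t / I) := by ring
    rw [hau, h2, ← h1]
    linarith [cdf_nonneg ν₂ t]
  set G : ℝ → ℝ := fun t => ∫ s in 0..t, W s with hG
  have hGd : ∀ t, HasDerivAt G (W t) t := fun t =>
    intervalIntegral.integral_hasDerivAt_right (hWc.intervalIntegrable _ _)
      (hWc.stronglyMeasurableAtFilter _ _) hWc.continuousAt
  have hWG : ∀ t, 0 ≤ t → W t ≤ 2 / I * G t := by
    intro t ht
    have := intervalIntegral.integral_mono_on ht (haii 0 t)
      ((hWc.const_mul (2 / I)).intervalIntegrable _ _) fun s hs => hbound s hs.1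
    rwa [intervalIntegral.integral_const_mul] at this
  have hGb := eq_zero_of_abs_deriv_le_mul_abs_self_of_eq_zero_right (f := G) (a := 0) (b := b)
    (K := 2 / I) (fun t _ => (hGd t).continuousAt.continuousWithinAt)
    (fun t _ => (hGd t).hasDerivWithinAt) (by simp [hG]) (fun t ht => by
      rw [Real.norm_of_nonneg (hW0 t ht.1)]
      exact (hWG t ht.1).trans (mul_le_mul_of_nonneg_left (le_abs_self _) (by positivity)))
    b ⟨hb.le, le_rfl⟩
  have h1 := hWG b hb.le
  rw [hGb, mul_zero] at h1
  have h2 := ha.integral_mul_eq hb.le fun _ => 1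
  simp only [mul_one] at h2
  linarith

theorem integral_id_of_isOptimal (hx : IsStatCurve R x) (hR : Continuous R)
    (hb : 0 < b) (hconv : StrictConvexOn ℝ (Icc 0 b) R) (h : IsOptimal R b ν) :
    ∫ r, r ∂ν = b / 2 := by
  have := h.prob
  have h' := hx.isOptimal_reflect h
  have he : MeasurableEmbedding fun t : ℝ => b - t :=
    (Homeomorph.subLeft b).measurableEmbedding
  have hi : Integrable (fun r : ℝ => r) ν := h.integrable continuous_id'
  have hi2 : Integrable (fun r : ℝ => r ^ 2) ν := h.integrable (by fun_prop)
  have hm : ∫ r, r ∂(ν.map fun t => b - t) = b - ∫ r, r ∂ν := by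
    rw [he.integral_map, integral_sub (integrable_const b) hi]
    simp
  have hs : ∫ r, r ^ 2 ∂(ν.map fun t => b - t)
      = b ^ 2 - 2 * b * (∫ r, r ∂ν) + ∫ r, r ^ 2 ∂ν := by
    rw [he.integral_map]
    have : ∀ r : ℝ, (b - r) ^ 2 = b ^ 2 - 2 * b * r + r ^ 2 := fun r => by ring
    have hi3 : Integrable (fun r : ℝ => b ^ 2 - 2 * b * r) ν :=
      (integrable_const _).sub (hi.const_mul _)
    simp_rw [this]
    rw [integral_add hi3 hi2,
      integral_sub (integrable_const _) (hi.const_mul _), integral_const_mul]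
    simp
  have heq : ν = ν.map fun t => b - t := by
    rcases hx.cdf_le_or_le hR hb hconv h h' with hle | hle
    · refine (hx.eq_of_cdf_le_of_moments hR hb hconv h' h hle ?_ ?_).symm
      · rw [hm]; ring
      · rw [hm, hs]; ring
    · refine hx.eq_of_cdf_le_of_moments hR hb hconv h h' hle ?_ ?_
      · rw [hm]; ring
      · rw [hm, hs]; ring
  rw [← heq] at hm
  linarith

theorem eq_of_isOptimal (hx : IsStatCurve R x) (hR : Continuous R)
    (hb : 0 < b) (hconv : StrictConvexOn ℝ (Icc 0 b) R) (h₁ : IsOptimal R b ν₁)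
    (h₂ : IsOptimal R b ν₂) : ν₁ = ν₂ :=
  hx.eq_of_integral_eq hR hb hconv h₁ h₂
    ((hx.integral_id_of_isOptimal hR hb hconv h₁).trans
      (hx.integral_id_of_isOptimal hR hb hconv h₂).symm)

end IsStatCurve

end Uniqueness

section Support

variable {b : ℝ} {ν : Measure ℝ} {H : Type*} [NormedAddCommGroup H] [InnerProductSpace ℝ H]
  [CompleteSpace H] {R : ℝ → ℝ} {x : ℝ → H}

theorem measSupport_eq_support (ν : Measure ℝ) : measSupport ν = ν.support := by
  rw [Measure.support_eq_forall_isOpen]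
  ext t
  exact ⟨fun h U ht hU => h U hU ht, fun h U hU ht => h U ht hU⟩

theorem IsProbOn.support_subset (h : IsProbOn b ν) : ν.support ⊆ Icc 0 b :=
  Measure.support_subset_of_isClosed isClosed_Icc h.ae_mem

namespace IsStatCurve

/-- An optimal measure cannot be translated inside `[0, b]`. -/
theorem eq_zero_of_translate (hx : IsStatCurve R x) (hR : Continuous R) (hb : 0 < b)
    (hconv : StrictConvexOn ℝ (Icc 0 b) R) (h : IsOptimal R b ν) {d : ℝ}
    (hd : ∀ᵐ t ∂ν, t + d ∈ Icc 0 b) : d = 0 := by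
  have := h.prob
  have h' : IsOptimal R b (ν.map fun t => t + d) := by
    refine ⟨h.toIsProbOn.map (by fun_prop) hd, fun ν' hν' => ?_⟩
    rw [statEnergy_map_add]
    exact h.le ν' hν'
  have he : MeasurableEmbedding fun t : ℝ => t + d :=
    (Homeomorph.addRight d).measurableEmbedding
  have h1 := hx.integral_id_of_isOptimal hR hb hconv h
  have h2 := hx.integral_id_of_isOptimal hR hb hconv h'
  rw [he.integral_map, integral_add (h.integrable continuous_id') (integrable_const d), h1] at h2
  simpa using h2

theorem norm_sq_le_potential (hx : IsStatCurve R x) (h : IsOptimal R b ν) {t : ℝ}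
    (ht : t ∈ Icc 0 b) : ‖∫ s, x s ∂ν‖ ^ 2 ≤ ∫ s, R (s - t) ∂ν := by
  have h1 := hx.norm_sq_le_inner h (isProbOn_dirac ht)
  rwa [integral_dirac, real_inner_comm, hx.inner_integral h.toIsProbOn] at h1

theorem potential_eq_of_mem_support (hx : IsStatCurve R x) (h : IsOptimal R b ν) {t : ℝ}
    (ht : t ∈ ν.support) : ∫ s, R (s - t) ∂ν = ‖∫ s, x s ∂ν‖ ^ 2 := by
  have := h.prob
  set U : ℝ → ℝ := fun t => ∫ s, R (s - t) ∂ν with hU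
  have hUc : Continuous U := by
    have : U = fun t => inner ℝ (x t) (∫ s, x s ∂ν) := by
      ext t; rw [hx.inner_integral h.toIsProbOn]
    rw [this]
    exact hx.continuous.inner continuous_const
  have hint : Integrable (fun t => U t - ‖∫ s, x s ∂ν‖ ^ 2) ν :=
    (h.integrable hUc).sub (integrable_const _)
  have h0 : ∫ t, (U t - ‖∫ s, x s ∂ν‖ ^ 2) ∂ν = 0 := by
    rw [integral_sub (h.integrable hUc) (integrable_const _), ← real_inner_self_eq_norm_sq,
      hx.inner_integral_integral h.toIsProbOn]
    simp_rw [hx.inner_integral h.toIsProbOn]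
    simp [hU]
  rw [integral_eq_zero_iff_of_nonneg_ae _ hint] at h0
  · by_contra hne
    rw [Measure.support_eq_forall_isOpen] at ht
    refine (ht {t | U t ≠ ‖∫ s, x s ∂ν‖ ^ 2} hne
      (isOpen_ne_fun hUc continuous_const)).ne' (measure_eq_zero_iff_ae_notMem.2 ?_)
    filter_upwards [h0] with t ht
    exact not_not.2 (sub_eq_zero.1 ht)
  · filter_upwards [h.ae_mem] with t ht
    exact sub_nonneg.2 (hx.norm_sq_le_potential h ht)

/-- The potential of an optimal measure is smaller than its minimum inside a gap of the support. -/
theorem false_of_gap (hx : IsStatCurve R x) (hR : Continuous R)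
    (hconv : StrictConvexOn ℝ (Icc 0 b) R) (h : IsOptimal R b ν) {α β t : ℝ} (hα : α ∈ ν.support)
    (hβ : β ∈ ν.support) (ht : t ∈ Ioo α β) (hgap : ∀ᵐ s ∂ν, s ∉ Ioo α β) : False := by
  have := h.prob
  have hα' := h.support_subset hα
  have hβ' := h.support_subset hβ
  obtain ⟨l, m, hl, hm, hlm, rfl⟩ := (Convex.mem_Ioo (ht.1.trans ht.2)).1 ht
  set t := l * α + m * β with htdef
  have hi : ∀ τ, Integrable (fun s => R (s - τ)) ν := fun τ => h.integrable (by fun_prop)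
  have hpos : ∀ᵐ s ∂ν, 0 < l * R (s - α) + m * R (s - β) - R (s - t) := by
    filter_upwards [hgap, h.ae_mem] with s hs hsb
    have hαβ := ht.1.trans ht.2
    rcases le_or_gt s α with hsα | hsα
    · have := hconv.2 (x := α - s) (y := β - s) ⟨by linarith, by linarith [hsb.1, hα'.2]⟩
        ⟨by linarith, by linarith [hsb.1, hβ'.2]⟩ (fun h => by linarith) hl hm hlm
      simp only [smul_eq_mul] at this
      rw [show l * (α - s) + m * (β - s) = t - s by
        rw [htdef, show m = 1 - l by linarith]; ring] at this
      rw [← hx.even (s - α), ← hx.even (s - β), ← hx.even (s - t), neg_sub, neg_sub, neg_sub]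
      linarith
    · have hsβ : β ≤ s := not_lt.1 fun h' => hs ⟨hsα, h'⟩
      have := hconv.2 (x := s - α) (y := s - β) ⟨by linarith, by linarith [hsb.2, hα'.1]⟩
        ⟨by linarith, by linarith [hsb.2, hβ'.1]⟩ (fun h => by linarith) hl hm hlm
      simp only [smul_eq_mul] at this
      rw [show l * (s - α) + m * (s - β) = s - t by
        rw [htdef, show m = 1 - l by linarith]; ring] at this
      linarith
  have hi' : Integrable (fun s => l * R (s - α) + m * R (s - β)) ν :=
    ((hi α).const_mul l).add ((hi β).const_mul m)
  have hint : Integrable (fun s => l * R (s - α) + m * R (s - β) - R (s - t)) ν :=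
    hi'.sub (hi t)
  have h0 : ∫ s, (l * R (s - α) + m * R (s - β) - R (s - t)) ∂ν = 0 := by
    refine le_antisymm ?_ (integral_nonneg_of_ae (hpos.mono fun s hs => hs.le))
    rw [integral_sub hi' (hi t),
      integral_add ((hi α).const_mul l) ((hi β).const_mul m), integral_const_mul,
      integral_const_mul, hx.potential_eq_of_mem_support h hα,
      hx.potential_eq_of_mem_support h hβ, ← add_mul, hlm, one_mul]
    exact sub_nonpos.2 (hx.norm_sq_le_potential h
      ⟨hα'.1.trans ht.1.le, ht.2.le.trans hβ'.2⟩)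
  rw [integral_eq_zero_iff_of_nonneg_ae (hpos.mono fun s hs => hs.le) hint] at h0
  have hfalse : ∀ᵐ s ∂ν, False := by
    filter_upwards [h0, hpos] with s hs hs'
    exact hs'.ne' hs
  exact hfalse.exists.choose_spec

theorem support_eq (hx : IsStatCurve R x) (hR : Continuous R) (hb : 0 < b)
    (hconv : StrictConvexOn ℝ (Icc 0 b) R) (h : IsOptimal R b ν) : ν.support = Icc 0 b := by
  refine h.support_subset.antisymm fun t ht => ?_
  by_contra htS
  have hclosed : IsClosed ν.support := Measure.isClosed_support
  have hae : ∀ᵐ s ∂ν, s ∈ ν.support := Measure.support_mem_ae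
  obtain ⟨ε, hε, hball⟩ := Metric.isOpen_iff.1 hclosed.isOpen_compl t htS
  have hgap : ∀ s ∈ ν.support, s ≤ t - ε ∨ t + ε ≤ s := by
    intro s hs
    by_contra! hlt
    exact hball (show s ∈ Metric.ball t ε by
      rw [Real.ball_eq_Ioo]; exact ⟨hlt.1, hlt.2⟩) hs
  have hl : (ν.support ∩ Iic t).Nonempty := by
    by_contra hne
    have hd := hx.eq_zero_of_translate hR hb hconv h (d := -(t + ε)) (by
      filter_upwards [hae, h.ae_mem] with s hs hsb
      have : t + ε ≤ s := (hgap s hs).resolve_left fun hle =>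
        hne ⟨s, hs, by simp only [mem_Iic]; linarith⟩
      exact ⟨by linarith, by linarith [ht.1, hsb.2]⟩)
    linarith [ht.1]
  have hr : (ν.support ∩ Ici t).Nonempty := by
    by_contra hne
    have hd := hx.eq_zero_of_translate hR hb hconv h (d := b - t + ε) (by
      filter_upwards [hae, h.ae_mem] with s hs hsb
      have : s ≤ t - ε := (hgap s hs).resolve_right fun hle =>
        hne ⟨s, hs, by simp only [mem_Ici]; linarith⟩
      exact ⟨by linarith [ht.2, hsb.1], by linarith⟩)
    linarith [ht.2]
  have hbl : BddAbove (ν.support ∩ Iic t) := ⟨t, fun _ hs => hs.2⟩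
  have hbr : BddBelow (ν.support ∩ Ici t) := ⟨t, fun _ hs => hs.2⟩
  have hα := (hclosed.inter isClosed_Iic).csSup_mem hl hbl
  have hβ := (hclosed.inter isClosed_Ici).csInf_mem hr hbr
  refine hx.false_of_gap hR hconv h hα.1 hβ.1
    ⟨lt_of_le_of_ne hα.2 fun he => htS (he ▸ hα.1),
      lt_of_le_of_ne hβ.2 fun he => htS (he ▸ hβ.1)⟩ ?_
  filter_upwards [hae] with s hs hsI
  rcases le_total s t with hst | hst
  · exact not_le.2 hsI.1 (le_csSup hbl ⟨hs, hst⟩)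
  · exact not_le.2 hsI.2 (csInf_le hbr ⟨hs, hst⟩)

end IsStatCurve

end Support

/-- For a centered stationary Gaussian process with continuous sample paths
whose covariance function `R` is strictly convex on `[0, b]`, the minimization of
`I(ν) = ∫∫ R(t-s) ν(ds) ν(dt)` over Borel probability measures on `[0, b]` has a unique
optimal measure, whose support is all of `[0, b]`. -/
theorem highMinima_stationary_strictlyConvex_unique_full_support
    {Ω : Type*} [MeasurableSpace Ω] (P : Measure Ω) [IsProbabilityMeasure P]
    (X : ℝ → Ω → ℝ) (R : ℝ → ℝ) (b : ℝ) (hb : 0 < b)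
    -- centered Gaussian process: every finite linear combination is centered Gaussian
    (hGauss : ∀ (n : ℕ) (t : Fin n → ℝ) (c : Fin n → ℝ),
      ∃ v : NNReal,
        Measure.map (fun ω => ∑ i, c i * X (t i) ω) P = gaussianReal 0 v)
    -- continuous sample paths
    (hpath : ∀ ω, Continuous fun t => X t ω)
    -- stationarity: the covariance function is `R(t - s)`
    (hcov : ∀ s t : ℝ, (∫ ω, X s ω * X t ω ∂P) = R (t - s))
    -- strict convexity of the covariance function on `[0, b]`
    (hconv : StrictConvexOn ℝ (Icc 0 b) R) :
    ∃ νstar : Measure ℝ,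
      (IsProbabilityMeasure νstar ∧ νstar (Icc 0 b)ᶜ = 0 ∧
        (∀ ν : Measure ℝ, IsProbabilityMeasure ν → ν (Icc 0 b)ᶜ = 0 →
          statEnergy R νstar ≤ statEnergy R ν)) ∧
      (∀ ν : Measure ℝ, IsProbabilityMeasure ν → ν (Icc 0 b)ᶜ = 0 →
        (∀ ν' : Measure ℝ, IsProbabilityMeasure ν' → ν' (Icc 0 b)ᶜ = 0 →
          statEnergy R ν ≤ statEnergy R ν') → ν = νstar) ∧
      measSupport νstar = Icc 0 b := by
  obtain ⟨x, hxc, hxi⟩ := exists_continuous_curve hGauss hpath hcov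
  have hx : IsStatCurve R x := ⟨hxc, hxi⟩
  have hR := continuous_cov hGauss hpath hcov
  obtain ⟨ν, hν⟩ := exists_isOptimal hR hb
  refine ⟨ν, ⟨hν.prob, hν.compl, fun ν' h₁ h₂ => hν.le ν' ⟨h₁, h₂⟩⟩, fun ν' h₁ h₂ h => ?_, ?_⟩
  · exact hx.eq_of_isOptimal hR hb hconv ⟨⟨h₁, h₂⟩, fun κ hκ => h κ hκ.prob hκ.compl⟩ hν
  · rw [measSupport_eq_support, hx.support_eq hR hb hconv hν]
end

section
/- Let R : [0,∞) → ℝ be continuous and strictly decreasing on [0, b] for some b > 0, and suppose ν* is a probability measure on [0,b] that minimizes I(ν) = ∫∫ R(|t − s|) ν(ds) ν(dt) over all Borel probability measures on [0,b]. Then the support of ν* is not a single point, and both endpoints 0 and b belong to the support of ν*. -/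
open MeasureTheory Filter Set

/-- The energy functional `I(ν) = ∫∫ R(|t - s|) ν(ds) ν(dt)`. -/
noncomputable def absEnergy (R : ℝ → ℝ) (ν : Measure ℝ) : ℝ :=
  ∫ s, ∫ t, R |t - s| ∂ν ∂ν

theorem ae_prod_abs_sub_mem_Icc {b : ℝ} (μ : Measure ℝ) [IsProbabilityMeasure μ]
    (hμ : μ (Icc 0 b)ᶜ = 0) :
    ∀ᵐ z ∂μ.prod μ, |z.2 - z.1| ∈ Icc 0 b := by
  have h : ∀ᵐ x ∂μ, x ∈ Icc 0 b := mem_ae_iff.2 hμ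
  filter_upwards [Measure.quasiMeasurePreserving_fst.ae h,
    Measure.quasiMeasurePreserving_snd.ae h] with z h1 h2
  refine ⟨abs_nonneg _, abs_le.2 ⟨?_, ?_⟩⟩ <;> linarith [h1.1, h1.2, h2.1, h2.2]

theorem integrable_kernel_prod {R : ℝ → ℝ} {b : ℝ} (hb : 0 ≤ b)
    (hR : ContinuousOn R (Icc 0 b)) (μ : Measure ℝ) [IsProbabilityMeasure μ]
    (hμ : μ (Icc 0 b)ᶜ = 0) :
    Integrable (fun z : ℝ × ℝ => R |z.2 - z.1|) (μ.prod μ) := by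
  have hcont : Continuous (IccExtend hb ((Icc 0 b).domRestrict R)) :=
    hR.domRestrict.Icc_extend'
  obtain ⟨C, hC⟩ := isCompact_Icc.exists_bound_of_continuousOn hR
  have hae := ae_prod_abs_sub_mem_Icc μ hμ
  refine Integrable.of_bound (C := C) ?_ ?_
  · refine AEStronglyMeasurable.congr
      (f := fun z : ℝ × ℝ => IccExtend hb ((Icc 0 b).domRestrict R) |z.2 - z.1|)
      (hcont.comp (by fun_prop)).aestronglyMeasurable ?_
    filter_upwards [hae] with z hz
    exact IccExtend_of_mem hb _ hz
  · filter_upwards [hae] with z hz using hC _ hz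

theorem absEnergy_eq_integral_prod {R : ℝ → ℝ} {b : ℝ} (hb : 0 ≤ b)
    (hR : ContinuousOn R (Icc 0 b)) (μ : Measure ℝ) [IsProbabilityMeasure μ]
    (hμ : μ (Icc 0 b)ᶜ = 0) :
    absEnergy R μ = ∫ z, R |z.2 - z.1| ∂μ.prod μ :=
  (integral_prod _ (integrable_kernel_prod hb hR μ hμ)).symm

/-- The measure with mass `1/2` at each of the points `0` and `b` has energy below `R 0`. -/
theorem exists_absEnergy_lt {R : ℝ → ℝ} {b : ℝ} (hb : 0 < b)
    (hR : R b < R 0) :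
    ∃ μ : Measure ℝ, IsProbabilityMeasure μ ∧ μ (Icc 0 b)ᶜ = 0 ∧ absEnergy R μ < R 0 := by
  have key : ∀ f : ℝ → ℝ, ∫ x, f x ∂((2⁻¹ : ENNReal) • (Measure.dirac 0 + Measure.dirac b))
      = 2⁻¹ * (f 0 + f b) := fun f => by
    rw [integral_smul_measure, integral_add_measure (integrable_dirac (by simp))
      (integrable_dirac (by simp))]
    simp
  refine ⟨(2⁻¹ : ENNReal) • (Measure.dirac 0 + Measure.dirac b), ⟨?_⟩, ?_, ?_⟩
  · simp [ENNReal.inv_two_add_inv_two]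
  · simp [hb.le]
  · simp only [absEnergy, key]
    simp only [sub_self, sub_zero, zero_sub, abs_neg, abs_zero, abs_of_pos hb]
    linarith

/-- A minimizer of the energy cannot be carried by an interval shorter than `b`: stretching
the interval onto `[0, b]` would lower the energy. -/
theorem measure_compl_Icc_ne_zero_of_optimal {R : ℝ → ℝ} {b : ℝ} (hb : 0 < b)
    (hRcont : ContinuousOn R (Icc 0 b)) (hRanti : StrictAntiOn R (Icc 0 b))
    (ν : Measure ℝ) [IsProbabilityMeasure ν] (hν : ν (Icc 0 b)ᶜ = 0)
    (hopt : ∀ μ : Measure ℝ, IsProbabilityMeasure μ → μ (Icc 0 b)ᶜ = 0 →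
      absEnergy R ν ≤ absEnergy R μ)
    {c d : ℝ} (hcd : c < d) (hlt : d - c < b) : ν (Icc c d)ᶜ ≠ 0 := by
  intro hνcd
  have hpos : 0 < d - c := sub_pos.2 hcd
  set k := b / (d - c) with hk
  have hk1 : 1 < k := (one_lt_div hpos).2 hlt
  have hkb : k * (d - c) = b := div_mul_cancel₀ _ hpos.ne'
  have hφ : Measurable fun x : ℝ => k * (x - c) := by fun_prop
  set μ := ν.map fun x : ℝ => k * (x - c) with hμdef
  have hμprob : IsProbabilityMeasure μ := Measure.isProbabilityMeasure_map hφ.aemeasurable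
  have hμ : μ (Icc 0 b)ᶜ = 0 := by
    rw [hμdef, Measure.map_apply hφ measurableSet_Icc.compl]
    refine measure_mono_null (fun x hx => mt (fun hxcd => ⟨?_, ?_⟩) hx) hνcd
    · exact mul_nonneg (by linarith) (sub_nonneg.2 hxcd.1)
    · rw [← hkb]
      exact mul_le_mul_of_nonneg_left (by linarith [hxcd.2]) (by linarith)
  have hprod : μ.prod μ =
      (ν.prod ν).map (Prod.map (fun x : ℝ => k * (x - c)) fun x : ℝ => k * (x - c)) :=
    Measure.map_prod_map ν ν hφ hφ
  have hdist : ∀ z : ℝ × ℝ, |k * (z.2 - c) - k * (z.1 - c)| = k * |z.2 - z.1| := fun z => by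
    rw [← mul_sub, abs_mul, abs_of_pos (by linarith), sub_sub_sub_cancel_right]
  have hintμ := integrable_kernel_prod hb.le hRcont μ hμ
  have hEμ := absEnergy_eq_integral_prod hb.le hRcont μ hμ
  have haeμ := ae_prod_abs_sub_mem_Icc μ hμ
  rw [hprod] at hintμ hEμ haeμ
  rw [integral_map (hφ.prodMap hφ).aemeasurable hintμ.aestronglyMeasurable] at hEμ
  replace hintμ := hintμ.comp_measurable (hφ.prodMap hφ)
  replace haeμ := ae_of_ae_map (hφ.prodMap hφ).aemeasurable haeμ
  simp only [Function.comp_def, Prod.map_fst, Prod.map_snd, hdist] at hEμ hintμ haeμ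
  have hintν := integrable_kernel_prod hb.le hRcont ν hν
  have hEν := absEnergy_eq_integral_prod hb.le hRcont ν hν
  have haeν := ae_prod_abs_sub_mem_Icc ν hν
  have hle : (fun z : ℝ × ℝ => R (k * |z.2 - z.1|)) ≤ᵐ[ν.prod ν] fun z => R |z.2 - z.1| := by
    filter_upwards [haeμ, haeν] with z hz hz'
    exact hRanti.antitoneOn hz' hz (le_mul_of_one_le_left (abs_nonneg _) hk1.le)
  have heq := (integral_eq_iff_of_ae_le hintμ hintν hle).1
    (le_antisymm (integral_mono_ae hintμ hintν hle) (hEν ▸ hEμ ▸ hopt μ hμprob hμ))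
  have hdiag : (fun z : ℝ × ℝ => R |z.2 - z.1|) =ᵐ[ν.prod ν] fun _ => R 0 := by
    filter_upwards [heq, haeμ, haeν] with z hz h1 h2
    have h := hRanti.injOn h1 h2 hz
    have h0 : |z.2 - z.1| = 0 := by
      have : (k - 1) * |z.2 - z.1| = 0 := by linarith
      exact (mul_eq_zero.1 this).resolve_left (by linarith)
    simp [h0]
  have hE0 : absEnergy R ν = R 0 := by
    rw [hEν, integral_congr_ae hdiag]
    simp
  obtain ⟨ρ, hρ, hρ', hρlt⟩ := exists_absEnergy_lt hb
    (hRanti (left_mem_Icc.2 hb.le) (right_mem_Icc.2 hb.le) hb)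
  linarith [hopt ρ hρ hρ']

/-- If `R` is continuous and strictly decreasing on `[0, b]`, `b > 0`, and
`ν*` is a probability measure on `[0, b]` minimizing `I(ν) = ∫∫ R(|t-s|) ν(ds) ν(dt)`
over all Borel probability measures on `[0, b]`, then the support of `ν*` is not a single
point, and both endpoints `0` and `b` belong to the support of `ν*`. -/
theorem optimal_measure_support_contains_endpoints
    (R : ℝ → ℝ) (b : ℝ) (hb : 0 < b)
    (hRcont : ContinuousOn R (Icc 0 b))
    (hRanti : StrictAntiOn R (Icc 0 b))
    (νstar : Measure ℝ) (hprob : IsProbabilityMeasure νstar)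
    (hsupp : νstar (Icc 0 b)ᶜ = 0)
    (hopt : ∀ ν : Measure ℝ, IsProbabilityMeasure ν → ν (Icc 0 b)ᶜ = 0 →
      absEnergy R νstar ≤ absEnergy R ν) :
    (∀ x : ℝ, measSupport νstar ≠ {x}) ∧
      (0 : ℝ) ∈ measSupport νstar ∧ b ∈ measSupport νstar := by
  have hnull : ∀ {c d : ℝ}, c < d → d - c < b → νstar (Icc c d)ᶜ ≠ 0 :=
    measure_compl_Icc_ne_zero_of_optimal hb hRcont hRanti νstar hsupp hopt
  have h0 : (0 : ℝ) ∈ measSupport νstar := by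
    intro U hU hmem
    refine pos_iff_ne_zero.2 fun hU0 => ?_
    obtain ⟨ε, hε, hball⟩ := Metric.isOpen_iff.1 hU 0 hmem
    have hδ : 0 < min ε (b / 2) := lt_min hε (by linarith)
    have hδb : min ε (b / 2) ≤ b / 2 := min_le_right _ _
    refine hnull (c := min ε (b / 2)) (d := b) (by linarith) (by linarith)
      (measure_mono_null (fun x hx => ?_) (measure_union_null hsupp hU0))
    by_contra h
    simp only [mem_union, mem_compl_iff, not_or, not_not] at h
    refine hx ⟨not_lt.1 fun hlt => h.2 (hball ?_), h.1.2⟩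
    rw [Metric.mem_ball, Real.dist_0_eq_abs, abs_of_nonneg h.1.1]
    exact hlt.trans_le (min_le_left _ _)
  have h1 : b ∈ measSupport νstar := by
    intro U hU hmem
    refine pos_iff_ne_zero.2 fun hU0 => ?_
    obtain ⟨ε, hε, hball⟩ := Metric.isOpen_iff.1 hU b hmem
    have hδ : 0 < min ε (b / 2) := lt_min hε (by linarith)
    have hδb : min ε (b / 2) ≤ b / 2 := min_le_right _ _
    refine hnull (c := 0) (d := b - min ε (b / 2)) (by linarith) (by linarith)
      (measure_mono_null (fun x hx => ?_) (measure_union_null hsupp hU0))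
    by_contra h
    simp only [mem_union, mem_compl_iff, not_or, not_not] at h
    refine hx ⟨h.1.1, not_lt.1 fun hlt => h.2 (hball ?_)⟩
    rw [Metric.mem_ball, Real.dist_eq, abs_sub_comm, abs_of_nonneg (sub_nonneg.2 h.1.2)]
    linarith [min_le_left ε (b / 2)]
  refine ⟨fun x hx => ?_, h0, h1⟩
  rw [hx, mem_singleton_iff] at h0 h1
  exact hb.ne (h0.trans h1.symm)
end

section
/- Let (B(t), t ≥ 0) be standard Brownian motion, 0 < a < b < ∞, and let g : [a,b] → (0,∞) be continuous and concave on [a,b], and nondecreasing and twice continuously differentiable on [a₀, b] for some a < a₀ < b satisfying g(a₀) = a₀ g'(a₀). Let X(t) = B(t)/g(t) with covariance R(s,t) = min(s,t)/(g(s)g(t)). Define f(x) = −g(x)g''(x) ≥ 0 for a₀ < x < b and p_b = g(b)g'(b) ≥ 0, and let μ be the finite measure on [a,b] given by μ(dx) = p_b δ_b(dx) + f(x) dx on [a₀, b] (and zero mass on [a, a₀)). Then the normalized measure μ/μ([a,b]) is an optimal solution of the minimization of I(ν) = ∫∫ R(s,t) ν(ds) ν(dt) over Borel probability measures on [a,b].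 -/
open MeasureTheory Filter Set

/-- The energy functional `I(ν) = ∫∫ R(s,t) ν(ds) ν(dt)`. -/
noncomputable def kernelEnergy (R : ℝ → ℝ → ℝ) (ν : Measure ℝ) : ℝ :=
  ∫ s, ∫ t, R s t ∂ν ∂ν

/-- Fubini for a bounded kernel of the form `(s, t) ↦ ∫ K(u,s) K(u,t) λ(du)`. -/
theorem integral_integral_gram_kernel {lam ν₁ ν₂ : Measure ℝ} [IsFiniteMeasure lam]
    [IsFiniteMeasure ν₁] [IsFiniteMeasure ν₂] {K : ℝ → ℝ → ℝ}
    (hK : Measurable (Function.uncurry K)) {C : ℝ} (hC : ∀ u t, |K u t| ≤ C) :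
    ∫ s, ∫ t, ∫ u, K u s * K u t ∂lam ∂ν₂ ∂ν₁
      = ∫ u, (∫ s, K u s ∂ν₁) * (∫ t, K u t ∂ν₂) ∂lam := by
  have hC0 : 0 ≤ C := (abs_nonneg _).trans (hC 0 0)
  have hF : StronglyMeasurable fun u => ∫ t, K u t ∂ν₂ :=
    hK.stronglyMeasurable.integral_prod_right
  have hFb : ∀ u, |∫ t, K u t ∂ν₂| ≤ C * ν₂.real univ := fun u => by
    rw [← Real.norm_eq_abs]
    exact norm_integral_le_of_norm_le_const (Eventually.of_forall fun t => hC u t)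
  have hKsw : Measurable fun p : ℝ × ℝ => K p.2 p.1 := hK.comp measurable_swap
  have inner : ∀ s, ∫ t, ∫ u, K u s * K u t ∂lam ∂ν₂
      = ∫ u, K u s * ∫ t, K u t ∂ν₂ ∂lam := by
    intro s
    rw [integral_integral_swap]
    · simp_rw [integral_const_mul]
    · refine Integrable.of_bound (C := C * C) ?_ (Eventually.of_forall fun p => ?_)
      · have h1 : Measurable fun p : ℝ × ℝ => K p.2 s :=
          hK.comp (measurable_snd.prodMk measurable_const)
        exact (h1.mul hKsw).aestronglyMeasurable
      · simp only [Function.uncurry, Real.norm_eq_abs, abs_mul]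
        exact mul_le_mul (hC _ _) (hC _ _) (abs_nonneg _) hC0
  simp_rw [inner]
  rw [integral_integral_swap]
  · simp_rw [integral_mul_const]
  · refine Integrable.of_bound (C := C * (C * ν₂.real univ)) ?_
      (Eventually.of_forall fun p => ?_)
    · exact (hKsw.mul (hF.measurable.comp measurable_snd)).aestronglyMeasurable
    · simp only [Function.uncurry, Real.norm_eq_abs, abs_mul]
      exact mul_le_mul (hC _ _) (hFb _) (abs_nonneg _) hC0

/-- The Gram kernel is positive semidefinite. -/
theorem gram_kernel_two_mul_cross_le {lam ν₁ ν₂ : Measure ℝ} [IsFiniteMeasure lam]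
    [IsFiniteMeasure ν₁] [IsFiniteMeasure ν₂] {K : ℝ → ℝ → ℝ}
    (hK : Measurable (Function.uncurry K)) {C : ℝ} (hC : ∀ u t, |K u t| ≤ C) :
    2 * ∫ s, ∫ t, ∫ u, K u s * K u t ∂lam ∂ν₂ ∂ν₁
      ≤ (∫ s, ∫ t, ∫ u, K u s * K u t ∂lam ∂ν₁ ∂ν₁)
        + ∫ s, ∫ t, ∫ u, K u s * K u t ∂lam ∂ν₂ ∂ν₂ := by
  simp_rw [integral_integral_gram_kernel hK hC]
  have hF : ∀ (ρ : Measure ℝ) [IsFiniteMeasure ρ], StronglyMeasurable fun u => ∫ t, K u t ∂ρ :=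
    fun ρ _ => hK.stronglyMeasurable.integral_prod_right
  have hFb : ∀ (ρ : Measure ℝ) [IsFiniteMeasure ρ] u, |∫ t, K u t ∂ρ| ≤ C * ρ.real univ :=
    fun ρ _ u => by
      rw [← Real.norm_eq_abs]
      exact norm_integral_le_of_norm_le_const (Eventually.of_forall fun t => hC u t)
  have h_integrable : ∀ (ρ σ : Measure ℝ) [IsFiniteMeasure ρ] [IsFiniteMeasure σ],
      Integrable (fun u => (∫ s, K u s ∂ρ) * (∫ t, K u t ∂σ)) lam := by
    intro ρ σ _ _
    refine Integrable.of_bound (C := (C * ρ.real univ) * (C * σ.real univ))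
      ((hF ρ).mul (hF σ)).aestronglyMeasurable (Eventually.of_forall fun u => ?_)
    rw [Real.norm_eq_abs, abs_mul]
    exact mul_le_mul (hFb ρ u) (hFb σ u) (abs_nonneg _) ((abs_nonneg _).trans (hFb ρ u))
  rw [← integral_const_mul, ← integral_add (h_integrable _ _) (h_integrable _ _)]
  refine integral_mono ((h_integrable _ _).const_mul 2) ((h_integrable _ _).add (h_integrable _ _)) fun u => ?_
  simp only
  nlinarith [sq_nonneg ((∫ s, K u s ∂ν₁) - ∫ t, K u t ∂ν₂)]

/-- Positive semidefiniteness of `φ(s) φ(t) min(s,t)` for a bounded weight `φ` supported in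
`[0, b]`. -/
theorem min_kernel_two_mul_cross_le {ν₁ ν₂ : Measure ℝ} [IsFiniteMeasure ν₁]
    [IsFiniteMeasure ν₂] {φ : ℝ → ℝ} (hφ : Measurable φ) {C b : ℝ} (hC : ∀ t, |φ t| ≤ C)
    (hsupp : ∀ t, t ∉ Icc 0 b → φ t = 0) :
    2 * ∫ s, ∫ t, φ s * (min s t * φ t) ∂ν₂ ∂ν₁
      ≤ (∫ s, ∫ t, φ s * (min s t * φ t) ∂ν₁ ∂ν₁) + ∫ s, ∫ t, φ s * (min s t * φ t) ∂ν₂ ∂ν₂ := by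
  have hC0 : 0 ≤ C := (abs_nonneg _).trans (hC 0)
  let K : ℝ → ℝ → ℝ := fun u t => if u ≤ t then φ t else 0
  have hK : Measurable (Function.uncurry K) :=
    Measurable.ite (measurableSet_le measurable_fst measurable_snd) (hφ.comp measurable_snd)
      measurable_const
  have hKC : ∀ u t, |K u t| ≤ C := by
    intro u t
    simp only [K]
    split_ifs
    · exact hC t
    · simpa using hC0
  have key : ∀ s t, φ s * (min s t * φ t)
      = ∫ u, K u s * K u t ∂(volume.restrict (Ioc 0 b)) := by
    intro s t
    by_cases hs : s ∈ Icc 0 b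
    swap
    · simp [K, hsupp s hs]
    by_cases ht : t ∈ Icc 0 b
    swap
    · simp [K, hsupp t ht]
    have h0 : 0 ≤ min s t := le_min hs.1 ht.1
    have hb : min s t ≤ b := (min_le_left _ _).trans hs.2
    have : ∀ u, K u s * K u t = (Iic (min s t)).indicator (fun _ => φ s * φ t) u := by
      intro u
      by_cases h1 : u ≤ s <;> by_cases h2 : u ≤ t <;> simp [K, indicator, h1, h2]
    simp_rw [this]
    rw [setIntegral_indicator measurableSet_Iic, setIntegral_const]
    have hset : Ioc 0 b ∩ Iic (min s t) = Ioc 0 (min s t) := by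
      ext u
      simp only [mem_inter_iff, mem_Ioc, mem_Iic]
      exact ⟨fun h => ⟨h.1.1, h.2⟩, fun h => ⟨⟨h.1, h.2.trans hb⟩, h.2⟩⟩
    rw [hset, Real.volume_real_Ioc_of_le h0, smul_eq_mul]
    ring
  simp_rw [key]
  exact gram_kernel_two_mul_cross_le hK hKC

/-- Integration by parts for the kernel `min(s,t)` against `-g''` on `[a₀, b]`. -/
theorem potential_min_second_deriv {a₀ b : ℝ} (hab : a₀ < b) {g g' g'' : ℝ → ℝ}
    (hg' : ∀ x ∈ Icc a₀ b, HasDerivWithinAt g (g' x) (Icc a₀ b) x)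
    (hg'' : ∀ x ∈ Icc a₀ b, HasDerivWithinAt g' (g'' x) (Icc a₀ b) x)
    (hg''cont : ContinuousOn g'' (Icc a₀ b)) (ha₀eq : g a₀ = a₀ * g' a₀) {s : ℝ} (hs : s ≤ b) :
    s * g' b - ∫ t in Icc a₀ b, min s t * g'' t
      = g (max s a₀) - max s a₀ * g' (max s a₀) + s * g' (max s a₀) := by
  set c := max s a₀ with hc
  have hac : a₀ ≤ c := le_max_right _ _
  have hcb : c ≤ b := max_le hs hab.le
  have hgc : ContinuousOn g (Icc a₀ b) := fun x hx => (hg' x hx).continuousWithinAt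
  have hg'c : ContinuousOn g' (Icc a₀ b) := fun x hx => (hg'' x hx).continuousWithinAt
  have hright : ∀ {F : ℝ → ℝ} {F' x : ℝ}, x ∈ Ico a₀ b →
      HasDerivWithinAt F F' (Icc a₀ b) x → HasDerivWithinAt F F' (Ioi x) x := by
    intro F F' x hx h
    exact (h.mono (Icc_subset_Icc_left hx.1)).mono_of_mem_nhdsWithin (Icc_mem_nhdsGT hx.2)
  have s1 : Icc a₀ c ⊆ Icc a₀ b := Icc_subset_Icc_right hcb
  have s2 : Icc c b ⊆ Icc a₀ b := Icc_subset_Icc_left hac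
  have e1 : ∫ t in a₀..c, t * g'' t = (c * g' c - g c) - (a₀ * g' a₀ - g a₀) := by
    refine intervalIntegral.integral_eq_sub_of_hasDeriv_right_of_le (f := fun t => t * g' t - g t)
      hac (((continuousOn_id.mul hg'c).sub hgc).mono s1) (fun x hx => ?_) ?_
    · have hx' : x ∈ Ico a₀ b := ⟨hx.1.le, hx.2.trans_le hcb⟩
      have h := (((hasDerivWithinAt_id x (Icc a₀ b)).mul
        (hg'' x (Ico_subset_Icc_self hx'))).sub (hg' x (Ico_subset_Icc_self hx')))
      exact (hright hx' h).congr_deriv (by simp)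
    · exact ((continuousOn_id.mul hg''cont).mono s1).intervalIntegrable_of_Icc hac
  have e2 : ∫ t in c..b, g'' t = g' b - g' c := by
    refine intervalIntegral.integral_eq_sub_of_hasDeriv_right_of_le hcb (hg'c.mono s2)
      (fun x hx => ?_) ((hg''cont.mono s2).intervalIntegrable_of_Icc hcb)
    have hx' : x ∈ Ico a₀ b := ⟨hac.trans hx.1.le, hx.2⟩
    exact hright hx' (hg'' x (Ico_subset_Icc_self hx'))
  have hminc : Continuous fun t => min s t := continuous_const.min continuous_id
  have hm : ContinuousOn (fun t => min s t * g'' t) (Icc a₀ b) := hminc.continuousOn.mul hg''cont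
  have f1 : ∫ t in a₀..c, min s t * g'' t = ∫ t in a₀..c, t * g'' t := by
    rcases le_total s a₀ with h | h
    · simp [hc, max_eq_right h]
    · refine intervalIntegral.integral_congr fun t ht => ?_
      rw [uIcc_of_le hac, hc, max_eq_left h] at ht
      simp only [min_eq_right ht.2]
  have f2 : ∫ t in c..b, min s t * g'' t = s * ∫ t in c..b, g'' t := by
    rw [← intervalIntegral.integral_const_mul]
    refine intervalIntegral.integral_congr fun t ht => ?_
    rw [uIcc_of_le hcb] at ht
    simp only [min_eq_left ((le_max_left s a₀).trans ht.1)]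
  rw [integral_Icc_eq_integral_Ioc, ← intervalIntegral.integral_of_le hab.le,
    ← intervalIntegral.integral_add_adjacent_intervals
      ((hm.mono s1).intervalIntegrable_of_Icc hac) ((hm.mono s2).intervalIntegrable_of_Icc hcb),
    f1, f2, e1, e2, ha₀eq]
  ring

/-- A concave function lies below its tangent line at an interior point, to the left of it,
the slope being a one-sided derivative from the right. -/
theorem ConcaveOn.le_tangent_left_of_hasDerivWithinAt_Icc {a a₀ b g₀ : ℝ} {g : ℝ → ℝ}
    (hg : ConcaveOn ℝ (Icc a b) g) (hb : a₀ < b) (hd : HasDerivWithinAt g g₀ (Icc a₀ b) a₀)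
    {s : ℝ} (has : a ≤ s) (hs : s < a₀) : g s ≤ g a₀ - g₀ * (a₀ - s) := by
  have hle : g₀ ≤ (g a₀ - g s) / (a₀ - s) := by
    have ht := (hasDerivWithinAt_iff_tendsto_slope.1 hd)
    rw [Icc_sdiff_left] at ht
    have : NeBot (nhdsWithin a₀ (Ioc a₀ b)) := left_nhdsWithin_Ioc_neBot hb
    refine le_of_tendsto ht (eventually_of_mem self_mem_nhdsWithin fun y hy => ?_)
    rw [slope_def_field]
    exact hg.slope_anti_adjacent ⟨has, hs.le.trans hb.le⟩
      ⟨has.trans (hs.le.trans hy.1.le), hy.2⟩ hs hy.1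
  rw [le_div_iff₀ (sub_pos.2 hs)] at hle
  linarith

/-- For the covariance kernel `R(s,t) = min(s,t)/(g(s)g(t))` of
`X(t) = B(t)/g(t)` on `[a,b]`, `0 < a < b`, with `g` positive and continuous and concave
on `[a,b]`, nondecreasing and twice continuously differentiable on `[a₀,b]` for some
`a < a₀ < b` with `g(a₀) = a₀ g'(a₀)`, the measure `μ(dx) = p_b δ_b(dx) + f(x) dx` on
`[a₀, b]` (no mass on `[a, a₀)`), where `f = -g g''` and `p_b = g(b) g'(b)`, is, after
normalization, an optimal solution of the minimization of `I(ν) = ∫∫ R(s,t) ν(ds) ν(dt)`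
over Borel probability measures on `[a,b]`. -/
theorem normalized_measure_optimal_for_BM_mod_interior_case
    (a a₀ b : ℝ) (ha : 0 < a) (ha₀ : a < a₀ ∧ a₀ < b)
    (g g' g'' : ℝ → ℝ)
    (hg_pos : ∀ x ∈ Icc a b, 0 < g x)
    (hg_cont : ContinuousOn g (Icc a b))
    (hg_conc : ConcaveOn ℝ (Icc a b) g)
    (hg_mono : MonotoneOn g (Icc a₀ b))
    (hg' : ∀ x ∈ Icc a₀ b, HasDerivWithinAt g (g' x) (Icc a₀ b) x)
    (hg'' : ∀ x ∈ Icc a₀ b, HasDerivWithinAt g' (g'' x) (Icc a₀ b) x)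
    (hg''cont : ContinuousOn g'' (Icc a₀ b))
    (ha₀eq : g a₀ = a₀ * g' a₀)
    (R : ℝ → ℝ → ℝ) (hR : ∀ s t, R s t = min s t / (g s * g t))
    (f : ℝ → ℝ) (hf : ∀ x, f x = -(g x * g'' x))
    (pb : ℝ) (hpb : pb = g b * g' b)
    (μ : Measure ℝ)
    (hμ : μ = ENNReal.ofReal pb • Measure.dirac b
        + (volume.restrict (Icc a₀ b)).withDensity (fun x => ENNReal.ofReal (f x))) :
    IsProbabilityMeasure ((μ Set.univ)⁻¹ • μ) ∧
    ((μ Set.univ)⁻¹ • μ) (Icc a b)ᶜ = 0 ∧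
    (∀ ν : Measure ℝ, IsProbabilityMeasure ν → ν (Icc a b)ᶜ = 0 →
      kernelEnergy R ((μ Set.univ)⁻¹ • μ) ≤ kernelEnergy R ν) := by
  obtain ⟨haa₀, ha₀b⟩ := ha₀
  have hab : a ≤ b := haa₀.le.trans ha₀b.le
  have hsub : Icc a₀ b ⊆ Icc a b := Icc_subset_Icc_left haa₀.le
  have hbmem : b ∈ Icc a₀ b := right_mem_Icc.2 ha₀b.le
  have hud := uniqueDiffOn_Icc ha₀b
  have hdw : ∀ x ∈ Icc a₀ b, derivWithin g (Icc a₀ b) x = g' x :=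
    fun x hx => (hg' x hx).derivWithin (hud x hx)
  have hg'b : 0 ≤ g' b := hdw b hbmem ▸ hg_mono.derivWithin_nonneg
  have hanti : AntitoneOn g' (Icc a₀ b) :=
    ((hg_conc.subset hsub (convex_Icc _ _)).antitoneOn_derivWithin
      fun x hx => (hg' x hx).differentiableWithinAt).congr hdw
  have hg''np : ∀ x ∈ Icc a₀ b, g'' x ≤ 0 := fun x hx => by
    rw [← (hg'' x hx).derivWithin (hud x hx)]
    exact hanti.derivWithin_nonpos
  have hf0 : ∀ x ∈ Icc a₀ b, 0 ≤ f x := fun x hx => by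
    rw [hf]
    nlinarith [hg''np x hx, hg_pos x (hsub hx)]
  have hpb0 : 0 ≤ pb := hpb ▸ mul_nonneg (hg_pos b (hsub hbmem)).le hg'b
  have hfc : ContinuousOn f (Icc a₀ b) :=
    (((hg_cont.mono hsub).mul hg''cont).neg).congr fun x _ => hf x
  have hfint : IntegrableOn f (Icc a₀ b) := hfc.integrableOn_Icc
  have : IsFiniteMeasure ((volume.restrict (Icc a₀ b)).withDensity
      fun x => ENNReal.ofReal (f x)) := isFiniteMeasure_withDensity_ofReal hfint.2
  have : IsFiniteMeasure (ENNReal.ofReal pb • Measure.dirac b) :=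
    Measure.smul_finite _ ENNReal.ofReal_ne_top
  have hμfin : IsFiniteMeasure μ := by rw [hμ]; infer_instance
  -- `μ` is carried by `[a₀, b]`
  have hμsupp : ∀ᵐ x ∂μ, x ∈ Icc a₀ b := by
    rw [hμ, ae_add_measure_iff]
    refine ⟨Measure.ae_smul_measure ?_ _, ?_⟩
    · exact (ae_dirac_iff measurableSet_Icc).2 hbmem
    · exact (withDensity_absolutelyContinuous _ _).ae_le (ae_restrict_mem measurableSet_Icc)
  -- the bounded measurable weight
  let φ : ℝ → ℝ := (Icc a b).indicator fun t => (g t)⁻¹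
  have hφin : ∀ t ∈ Icc a b, φ t = (g t)⁻¹ := fun t ht => indicator_of_mem ht _
  have hinvc : ContinuousOn (fun t => (g t)⁻¹) (Icc a b) :=
    hg_cont.inv₀ fun x hx => (hg_pos x hx).ne'
  have hφm : Measurable φ := by
    classical
    have := hinvc.measurable_piecewise (g := 0) continuousOn_const
      measurableSet_Icc
    rwa [piecewise_eq_indicator] at this
  obtain ⟨C, hC⟩ : ∃ C, ∀ t, |φ t| ≤ C := by
    obtain ⟨C, hC⟩ := isCompact_Icc.exists_bound_of_continuousOn hinvc
    refine ⟨max C 0, fun t => ?_⟩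
    by_cases ht : t ∈ Icc a b
    · rw [hφin t ht]
      exact (hC t ht).trans (le_max_left _ _)
    · simp [φ, ht]
  have hφsupp : ∀ t, t ∉ Icc 0 b → φ t = 0 := fun t ht =>
    indicator_of_notMem (fun h => ht ⟨ha.le.trans h.1, h.2⟩) _
  have henergy : ∀ ν : Measure ℝ, ν (Icc a b)ᶜ = 0 →
      kernelEnergy R ν = ∫ s, ∫ t, φ s * (min s t * φ t) ∂ν ∂ν := by
    intro ν hν
    have hmem : ∀ᵐ x ∂ν, x ∈ Icc a b := hν
    refine integral_congr_ae (hmem.mono fun s hs => integral_congr_ae (hmem.mono fun t ht => ?_))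
    simp only [hR, hφin s hs, hφin t ht, div_eq_mul_inv, mul_inv]
    ring
  -- the potential of `μ`
  have hpot : ∀ s, s ≤ b → ∫ t, min s t * φ t ∂μ
      = g (max s a₀) - max s a₀ * g' (max s a₀) + s * g' (max s a₀) := by
    intro s hs
    have hbound : ∀ t ∈ Icc a₀ b, |min s t * φ t| ≤ (|s| + |b| + |a₀|) * C := by
      intro t ht
      rw [abs_mul]
      refine mul_le_mul ?_ (hC t) (abs_nonneg _) (by positivity)
      rcases min_choice s t with h | h <;> rw [h]
      · linarith [abs_nonneg b, abs_nonneg a₀]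
      · refine abs_le.2 ⟨?_, ?_⟩
        · linarith [ht.1, neg_abs_le a₀, abs_nonneg s, abs_nonneg b]
        · linarith [ht.2, le_abs_self b, abs_nonneg s, abs_nonneg a₀]
    have hmeas : Measurable fun t => min s t * φ t :=
      (measurable_const.min measurable_id).mul hφm
    have h_integrable : Integrable (fun t => min s t * φ t) μ :=
      Integrable.of_bound hmeas.aestronglyMeasurable _ (hμsupp.mono hbound)
    rw [← potential_min_second_deriv ha₀b hg' hg'' hg''cont ha₀eq hs]
    rw [hμ] at h_integrable ⊢
    rw [integral_add_measure h_integrable.left_of_add_measure h_integrable.right_of_add_measure,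
      integral_smul_measure, integral_dirac, ENNReal.toReal_ofReal hpb0,
      integral_withDensity_eq_integral_toReal_smul₀ hfint.aemeasurable.ennreal_ofReal
        (Eventually.of_forall fun x => ENNReal.ofReal_lt_top),
      sub_eq_add_neg, ← integral_neg]
    congr 1
    · rw [min_eq_left hs, hφin b (hsub hbmem), hpb, smul_eq_mul]
      have := (hg_pos b (hsub hbmem)).ne'
      field_simp
    · refine setIntegral_congr_fun measurableSet_Icc fun t ht => ?_
      have := (hg_pos t (hsub ht)).ne'
      simp only [ENNReal.toReal_ofReal (hf0 t ht), hφin t (hsub ht), smul_eq_mul]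
      rw [hf]
      field_simp
  have hpot_eq : ∀ s ∈ Icc a₀ b, φ s * ∫ t, min s t * φ t ∂μ = 1 := by
    intro s hs
    rw [hpot s hs.2, max_eq_left hs.1, hφin s (hsub hs), sub_add_cancel]
    exact inv_mul_cancel₀ (hg_pos s (hsub hs)).ne'
  have hpot_ge : ∀ s ∈ Icc a b, 1 ≤ φ s * ∫ t, min s t * φ t ∂μ := by
    intro s hs
    rcases le_or_gt a₀ s with h | h
    · exact (hpot_eq s ⟨h, hs.2⟩).ge
    · rw [hpot s hs.2, max_eq_right h.le, hφin s hs, ha₀eq, sub_self, zero_add,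
        ← div_eq_inv_mul, one_le_div₀ (hg_pos s hs)]
      have := hg_conc.le_tangent_left_of_hasDerivWithinAt_Icc ha₀b
        (hg' a₀ (left_mem_Icc.2 ha₀b.le)) hs.1 h
      rw [ha₀eq] at this
      linarith
  have hμ0 : μ ≠ 0 := by
    intro h
    have := hpot_eq b hbmem
    simp [h] at this
  have : NeZero μ := ⟨hμ0⟩
  set ρ := (μ univ)⁻¹ • μ with hρ
  have hρprob : IsProbabilityMeasure ρ := isProbabilityMeasureSMul
  have hρmem : ∀ᵐ x ∂ρ, x ∈ Icc a₀ b := Measure.ae_smul_measure hμsupp _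
  have hρsupp : ρ (Icc a b)ᶜ = 0 := hρmem.mono hsub
  refine ⟨hρprob, hρsupp, fun ν hνprob hν => ?_⟩
  set m := ((μ univ)⁻¹).toReal with hm
  have hm0 : 0 ≤ m := ENNReal.toReal_nonneg
  have hρpot : ∀ s, ∫ t, φ s * (min s t * φ t) ∂ρ = m * (φ s * ∫ t, min s t * φ t ∂μ) := by
    intro s
    rw [integral_const_mul, hρ, integral_smul_measure, smul_eq_mul]
    ring
  have hρen : ∫ s, ∫ t, φ s * (min s t * φ t) ∂ρ ∂ρ = m := by
    have : ∀ᵐ s ∂ρ, ∫ t, φ s * (min s t * φ t) ∂ρ = m :=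
      hρmem.mono fun s hs => by rw [hρpot, hpot_eq s hs, mul_one]
    rw [integral_congr_ae this]
    simp
  have hνmem : ∀ᵐ x ∂ν, x ∈ Icc a b := hν
  have hcross : m ≤ ∫ s, ∫ t, φ s * (min s t * φ t) ∂ρ ∂ν := by
    have hle : ∀ᵐ s ∂ν, m ≤ ∫ t, φ s * (min s t * φ t) ∂ρ :=
      hνmem.mono fun s hs => by
        rw [hρpot]
        exact le_mul_of_one_le_right hm0 (hpot_ge s hs)
    have hmeas : StronglyMeasurable fun s => ∫ t, φ s * (min s t * φ t) ∂ρ := by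
      refine StronglyMeasurable.integral_prod_right (Measurable.stronglyMeasurable ?_)
      exact (hφm.comp measurable_fst).mul
        ((measurable_fst.min measurable_snd).mul (hφm.comp measurable_snd))
    have hbd : ∀ᵐ s ∂ν, ‖∫ t, φ s * (min s t * φ t) ∂ρ‖ ≤ C * (b * C) * ρ.real univ := by
      refine hνmem.mono fun s hs => norm_integral_le_of_norm_le_const (hρmem.mono fun t ht => ?_)
      have h0 : 0 ≤ min s t := le_min (ha.le.trans hs.1) ((ha.le.trans haa₀.le).trans ht.1)
      have hC0 : 0 ≤ C := (abs_nonneg _).trans (hC 0)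
      rw [norm_mul, norm_mul, Real.norm_of_nonneg h0]
      have hb0 : 0 ≤ b := ha.le.trans hab
      exact mul_le_mul (hC s) (mul_le_mul ((min_le_left _ _).trans hs.2) (hC t) (abs_nonneg _) hb0)
        (mul_nonneg h0 (abs_nonneg _)) hC0
    calc m = ∫ _, m ∂ν := by simp
      _ ≤ _ := integral_mono_ae (integrable_const m)
        (Integrable.of_bound hmeas.aestronglyMeasurable _ hbd) hle
  have hpsd := min_kernel_two_mul_cross_le (ν₁ := ν) (ν₂ := ρ) hφm hC hφsupp
  rw [henergy ρ hρsupp, henergy ν hν]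
  linarith
end

section
/- Let f : (0,∞) → (0,∞) be a bounded measurable function such that lim_{ε↓0} ε^β log f(ε) = −c for some β, c ∈ (0,∞). Then there exists C ∈ (0,∞) such that lim_{x→∞} x^{−β/(1+β)} log ∫_0^∞ e^{−xε} f(ε) dε = −C. -/
open MeasureTheory Filter Set Real

/-- Scaling identity for the exponent `x ε + c ε^{-β}`. -/
lemma mul_add_mul_rpow_neg_scaling {β c x t : ℝ} (hβ : 0 < β) (hx : 0 < x) (ht : 0 < t) :
    x * (t * x ^ (-(1 / (1 + β)))) + c * (t * x ^ (-(1 / (1 + β)))) ^ (-β) =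
      x ^ (β / (1 + β)) * (t + c * t ^ (-β)) := by
  have h1 : x * x ^ (-(1 / (1 + β))) = x ^ (β / (1 + β)) := by
    nth_rewrite 1 [← Real.rpow_one x]
    rw [← Real.rpow_add hx]
    congr 1
    field_simp
    ring
  have h2 : (x ^ (-(1 / (1 + β)))) ^ (-β) = x ^ (β / (1 + β)) := by
    rw [← Real.rpow_mul hx.le]
    congr 1
    field_simp
  rw [Real.mul_rpow ht.le (Real.rpow_nonneg hx.le _), h2, ← h1]
  ring

/-- A lower bound for `t + c t^{-β}` scales to one for `x ε + c ε^{-β}`. -/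
lemma rpow_mul_le_mul_add_mul_rpow_neg {β c C x ε : ℝ} (hβ : 0 < β) (hx : 0 < x) (hε : 0 < ε)
    (hC : ∀ t > 0, C ≤ t + c * t ^ (-β)) :
    x ^ (β / (1 + β)) * C ≤ x * ε + c * ε ^ (-β) := by
  have hs : 0 < x ^ (-(1 / (1 + β))) := Real.rpow_pos_of_pos hx _
  have ht : 0 < ε / x ^ (-(1 / (1 + β))) := div_pos hε hs
  have h := mul_add_mul_rpow_neg_scaling (c := c) hβ hx ht
  rw [div_mul_cancel₀ _ hs.ne'] at h
  rw [h]
  exact mul_le_mul_of_nonneg_left (hC _ ht) (Real.rpow_nonneg hx.le _)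

lemma min_one_le_add_mul_rpow_neg {β c t : ℝ} (hβ : 0 < β) (hc : 0 < c) (ht : 0 < t) :
    min 1 c ≤ t + c * t ^ (-β) := by
  have hp : 0 < t ^ (-β) := Real.rpow_pos_of_pos ht _
  rcases le_total t 1 with h | h
  · have h1 : 1 ≤ t ^ (-β) := Real.one_le_rpow_of_pos_of_le_one_of_nonpos ht h (by linarith)
    exact (min_le_right _ _).trans (by nlinarith)
  · exact (min_le_left _ _).trans (by nlinarith [mul_pos hc hp])

lemma integrableOn_exp_neg_mul_mul {f : ℝ → ℝ} (hf_meas : Measurable f)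
    (hf_pos : ∀ ε > 0, 0 < f ε) {M : ℝ} (hM : ∀ ε > 0, f ε ≤ M) {x : ℝ} (hx : 0 < x) :
    IntegrableOn (fun ε => Real.exp (-(x * ε)) * f ε) (Ioi 0) := by
  have h : IntegrableOn (fun ε => Real.exp (-x * ε) * M) (Ioi 0) :=
    (exp_neg_integrableOn_Ioi 0 hx).mul_const M
  refine Integrable.mono' h (by fun_prop) ?_
  filter_upwards [ae_restrict_mem measurableSet_Ioi] with ε hε
  have hε : 0 < ε := hε
  rw [Real.norm_eq_abs, abs_of_pos (mul_pos (Real.exp_pos _) (hf_pos ε hε)), neg_mul]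
  exact mul_le_mul_of_nonneg_left (hM ε hε) (Real.exp_pos _).le

/-- If `f ε ≤ exp (-r c ε^{-β})` near `0`, the Laplace transform of `f` is at most a constant times
`exp (-r C x^{β/(1+β)})` for large `x`. -/
lemma eventually_integral_exp_neg_mul_mul_le {f : ℝ → ℝ} (hf_meas : Measurable f)
    (hf_pos : ∀ ε > 0, 0 < f ε) {M : ℝ} (hM : ∀ ε > 0, f ε ≤ M) {β c C r : ℝ} (hβ : 0 < β)
    (hC : ∀ t > 0, C ≤ t + c * t ^ (-β)) (hr : 0 < r) (hr1 : r < 1) {ε₀ : ℝ} (hε₀ : 0 < ε₀)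
    (hf : ∀ ε > 0, ε < ε₀ → f ε ≤ Real.exp (-(r * c * ε ^ (-β)))) :
    ∃ K : ℝ, 0 < K ∧ ∀ᶠ x : ℝ in atTop,
      ∫ ε in Ioi (0 : ℝ), Real.exp (-(x * ε)) * f ε ≤
        K * Real.exp (-(r * (x ^ (β / (1 + β)) * C))) := by
  have hMpos : 0 < M := (hf_pos 1 one_pos).trans_le (hM 1 one_pos)
  refine ⟨(1 + M) * Real.exp ε₀, by positivity, ?_⟩
  have hlit : ∀ᶠ x : ℝ in atTop, r * (x ^ (β / (1 + β)) * C) ≤ x * ε₀ := by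
    have hγ : β / (1 + β) < 1 := (div_lt_one (by positivity)).2 (by linarith)
    have h := (tendsto_rpow_neg_atTop (sub_pos.2 hγ)).const_mul (r * C)
    rw [mul_zero] at h
    filter_upwards [h.eventually_lt_const hε₀, eventually_gt_atTop 0] with x hx hx0
    have hsplit : x ^ (β / (1 + β)) = x * x ^ (-(1 - β / (1 + β))) := by
      rw [neg_sub, Real.rpow_sub_one hx0.ne', mul_div_cancel₀ _ hx0.ne']
    rw [hsplit]
    linarith [mul_le_mul_of_nonneg_left hx.le hx0.le]
  filter_upwards [hlit, eventually_ge_atTop 1] with x hx hx1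
  have hx0 : 0 < x := by linarith
  set A := Real.exp (-(r * (x ^ (β / (1 + β)) * C))) with hA
  have hE : IntegrableOn (fun ε : ℝ => (1 + M) * Real.exp ε₀ * A * Real.exp (-ε)) (Ioi 0) :=
    (integrableOn_exp_neg_Ioi 0).const_mul _
  have hle : ∀ ε ∈ Ioi (0 : ℝ),
      Real.exp (-(x * ε)) * f ε ≤ (1 + M) * Real.exp ε₀ * A * Real.exp (-ε) := by
    intro ε hε
    have hε : 0 < ε := hε
    rcases lt_or_ge ε ε₀ with h | h
    · have hsc := rpow_mul_le_mul_add_mul_rpow_neg hβ hx0 hε hC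
      calc Real.exp (-(x * ε)) * f ε
          ≤ Real.exp (-(x * ε)) * Real.exp (-(r * c * ε ^ (-β))) :=
            mul_le_mul_of_nonneg_left (hf ε hε h) (Real.exp_pos _).le
        _ ≤ Real.exp ε₀ * A * Real.exp (-ε) := by
            rw [hA, ← Real.exp_add, ← Real.exp_add, ← Real.exp_add]
            refine Real.exp_le_exp.2 ?_
            nlinarith [mul_le_mul_of_nonneg_left hsc hr.le, mul_pos hx0 hε]
        _ ≤ (1 + M) * (Real.exp ε₀ * A * Real.exp (-ε)) :=
            le_mul_of_one_le_left (by positivity) (by linarith)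
        _ = _ := by ring
    · calc Real.exp (-(x * ε)) * f ε
          ≤ Real.exp (-(x * ε)) * M :=
            mul_le_mul_of_nonneg_left (hM ε hε) (Real.exp_pos _).le
        _ ≤ Real.exp ε₀ * A * Real.exp (-ε) * M := by
            refine mul_le_mul_of_nonneg_right ?_ hMpos.le
            rw [hA, ← Real.exp_add, ← Real.exp_add]
            refine Real.exp_le_exp.2 ?_
            nlinarith [mul_nonneg (sub_nonneg.2 hx1) (sub_nonneg.2 h)]
        _ ≤ Real.exp ε₀ * A * Real.exp (-ε) * (1 + M) :=
            mul_le_mul_of_nonneg_left (by linarith) (by positivity)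
        _ = _ := by ring
  refine (setIntegral_mono_on (integrableOn_exp_neg_mul_mul hf_meas hf_pos hM hx0) hE
    measurableSet_Ioi hle).trans_eq ?_
  rw [integral_const_mul, integral_exp_neg_Ioi_zero, mul_one]

/-- If `exp (-R c ε^{-β}) ≤ f ε` near `0`, restricting the Laplace integral to a window of width
proportional to `x^{-1/(1+β)}` bounds it below. -/
lemma eventually_le_integral_exp_neg_mul_mul {f : ℝ → ℝ} (hf_meas : Measurable f)
    (hf_pos : ∀ ε > 0, 0 < f ε) {M : ℝ} (hM : ∀ ε > 0, f ε ≤ M) {β c R t : ℝ} (hβ : 0 < β)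
    (hc : 0 < c) (hR : 1 < R) (ht : 0 < t) {ε₀ : ℝ} (hε₀ : 0 < ε₀)
    (hf : ∀ ε > 0, ε < ε₀ → Real.exp (-(R * c * ε ^ (-β))) ≤ f ε) :
    ∀ᶠ x : ℝ in atTop,
      (R - 1) * t * x ^ (-(1 / (1 + β))) *
          Real.exp (-(R * (x ^ (β / (1 + β)) * (t + c * t ^ (-β))))) ≤
        ∫ ε in Ioi (0 : ℝ), Real.exp (-(x * ε)) * f ε := by
  have hsmall : ∀ᶠ x : ℝ in atTop, R * t * x ^ (-(1 / (1 + β))) < ε₀ := by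
    have h := (tendsto_rpow_neg_atTop (y := 1 / (1 + β)) (by positivity)).const_mul (R * t)
    rw [mul_zero] at h
    exact h.eventually_lt_const hε₀
  filter_upwards [hsmall, eventually_gt_atTop 0] with x hx hx0
  have hsc := mul_add_mul_rpow_neg_scaling (c := c) hβ hx0 ht
  set s := x ^ (-(1 / (1 + β))) with hs
  have hs0 : 0 < s := Real.rpow_pos_of_pos hx0 _
  have hts : 0 < t * s := mul_pos ht hs0
  have hint := integrableOn_exp_neg_mul_mul hf_meas hf_pos hM hx0
  have hsub : Ioc (t * s) (R * (t * s)) ⊆ Ioi 0 := fun ε hε => hts.trans hε.1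
  set B := Real.exp (-(R * (x ^ (β / (1 + β)) * (t + c * t ^ (-β))))) with hB
  calc (R - 1) * t * s * B = ∫ _ε in Ioc (t * s) (R * (t * s)), B := by
        rw [setIntegral_const, Real.volume_real_Ioc_of_le (by nlinarith), smul_eq_mul]
        ring
    _ ≤ ∫ ε in Ioc (t * s) (R * (t * s)), Real.exp (-(x * ε)) * f ε := by
        refine setIntegral_mono_on (integrableOn_const (by simp)) (hint.mono_set hsub)
          measurableSet_Ioc fun ε hε => ?_
        have hε0 : 0 < ε := hsub hε
        refine le_trans ?_ (mul_le_mul_of_nonneg_left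
          (hf ε hε0 (hε.2.trans_lt (by linarith))) (Real.exp_pos _).le)
        rw [hB, ← Real.exp_add, ← hsc]
        refine Real.exp_le_exp.2 ?_
        have h1 : ε ^ (-β) ≤ (t * s) ^ (-β) :=
          Real.rpow_le_rpow_of_nonpos hts hε.1.le (by linarith)
        have h2 := mul_le_mul_of_nonneg_left h1 (mul_pos (by linarith : 0 < R) hc).le
        have h3 := mul_le_mul_of_nonneg_left hε.2 hx0.le
        linarith
    _ ≤ _ := by
        refine setIntegral_mono_set hint ?_ hsub.eventuallyLE
        filter_upwards [ae_restrict_mem measurableSet_Ioi] with ε hε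
        exact (mul_pos (Real.exp_pos _) (hf_pos ε hε)).le

/-- If `f : (0,∞) → (0,∞)` is bounded and measurable with
`lim_{ε↓0} ε^β log f(ε) = -c` for some `β, c ∈ (0,∞)`, then there exists `C ∈ (0,∞)` with
`lim_{x→∞} x^{-β/(1+β)} log ∫_0^∞ e^{-xε} f(ε) dε = -C`. -/
theorem laplace_transform_exponential_tauberian
    (f : ℝ → ℝ) (hf_meas : Measurable f)
    (hf_pos : ∀ ε > 0, 0 < f ε)
    (hf_bdd : ∃ M : ℝ, ∀ ε > 0, f ε ≤ M)
    (β c : ℝ) (hβ : 0 < β) (hc : 0 < c)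
    (hlim : Tendsto (fun ε : ℝ => ε ^ β * Real.log (f ε))
      (nhdsWithin 0 (Ioi 0)) (nhds (-c))) :
    ∃ C : ℝ, 0 < C ∧
      Tendsto (fun x : ℝ =>
          x ^ (-(β / (1 + β))) *
            Real.log (∫ ε in Ioi (0 : ℝ), Real.exp (-(x * ε)) * f ε))
        atTop (nhds (-C)) := by
  obtain ⟨M, hM⟩ := hf_bdd
  set S := (fun t : ℝ => t + c * t ^ (-β)) '' Ioi 0 with hS
  have hSne : S.Nonempty := nonempty_Ioi.image _
  have hSlb : min 1 c ∈ lowerBounds S := by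
    rintro _ ⟨t, ht, rfl⟩
    exact min_one_le_add_mul_rpow_neg hβ hc ht
  have hCpos : 0 < sInf S := (lt_min one_pos hc).trans_le (le_csInf hSne hSlb)
  have hC : ∀ t > 0, sInf S ≤ t + c * t ^ (-β) := fun t ht =>
    csInf_le ⟨_, hSlb⟩ ⟨t, ht, rfl⟩
  have hγ : 0 < β / (1 + β) := by positivity
  have hpow : ∀ x > 0, x ^ (-(β / (1 + β))) * x ^ (β / (1 + β)) = (1 : ℝ) := fun x hx => by
    rw [← Real.rpow_add hx, neg_add_cancel, Real.rpow_zero]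
  have hlow : ∀ R t : ℝ, 1 < R → 0 < t → ∀ᶠ x : ℝ in atTop,
      (R - 1) * t * x ^ (-(1 / (1 + β))) *
          Real.exp (-(R * (x ^ (β / (1 + β)) * (t + c * t ^ (-β))))) ≤
        ∫ ε in Ioi (0 : ℝ), Real.exp (-(x * ε)) * f ε := by
    intro R t hR ht
    obtain ⟨ε₀, hε₀, h⟩ := mem_nhdsGT_iff_exists_Ioo_subset.1
      (hlim.eventually_const_lt (by nlinarith : -(R * c) < -c))
    refine eventually_le_integral_exp_neg_mul_mul hf_meas hf_pos hM hβ hc hR ht hε₀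
      fun ε hε hlt => (Real.le_log_iff_exp_le (hf_pos ε hε)).1 ?_
    have h1 : -(R * c) < ε ^ β * Real.log (f ε) := h ⟨hε, hlt⟩
    have hp := Real.rpow_pos_of_pos hε β
    rw [Real.rpow_neg hε.le, ← div_eq_mul_inv, ← neg_div, div_le_iff₀ hp]
    linarith
  refine ⟨sInf S, hCpos, tendsto_order.2 ⟨fun a ha => ?_, fun b hb => ?_⟩⟩
  · obtain ⟨_, ⟨t, ht, rfl⟩, hta⟩ := exists_lt_of_csInf_lt hSne (show sInf S < -a by linarith)
    have ht : 0 < t := ht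
    set G := t + c * t ^ (-β) with hG
    have hGpos : 0 < G := hCpos.trans_le (hC t ht)
    obtain ⟨R, hR, hRa⟩ := exists_between ((one_lt_div hGpos).2 hta)
    rw [lt_div_iff₀ hGpos] at hRa
    have hlog : Tendsto (fun x : ℝ => x ^ (-(β / (1 + β))) * Real.log ((R - 1) * t) +
        -(1 / (1 + β)) * (Real.log x / x ^ (β / (1 + β))) - R * G) atTop
        (nhds (0 * Real.log ((R - 1) * t) + -(1 / (1 + β)) * 0 - R * G)) :=
      (((tendsto_rpow_neg_atTop hγ).mul_const _).add
        ((isLittleO_log_rpow_atTop hγ).tendsto_div_nhds_zero.const_mul _)).sub_const _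
    filter_upwards [hlog.eventually_const_lt (show a < _ by linarith), hlow R t hR ht,
      eventually_gt_atTop 0] with x h1 h2 hx
    have hRt : 0 < (R - 1) * t := mul_pos (by linarith) ht
    have hs := Real.rpow_pos_of_pos hx (-(1 / (1 + β)))
    have h3 := Real.log_le_log (by positivity) h2
    rw [Real.log_mul (by positivity) (by positivity), Real.log_exp,
      Real.log_mul hRt.ne' hs.ne', Real.log_rpow hx] at h3
    have h4 := mul_le_mul_of_nonneg_left h3 (Real.rpow_nonneg hx.le (-(β / (1 + β))))
    refine h1.trans_le (le_trans (le_of_eq ?_) h4)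
    rw [div_eq_mul_inv (Real.log x), ← Real.rpow_neg hx.le]
    linear_combination R * G * hpow x hx
  · obtain ⟨r, hr, hr1⟩ := exists_between
      (show max 0 (-b / sInf S) < 1 from max_lt one_pos ((div_lt_one hCpos).2 (by linarith)))
    obtain ⟨hr0, hrb⟩ := max_lt_iff.1 hr
    rw [div_lt_iff₀ hCpos] at hrb
    obtain ⟨ε₀, hε₀, h⟩ := mem_nhdsGT_iff_exists_Ioo_subset.1
      (hlim.eventually_lt_const (by nlinarith : -c < -(r * c)))
    obtain ⟨K, hK, hup⟩ := eventually_integral_exp_neg_mul_mul_le hf_meas hf_pos hM hβ hC hr0 hr1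
      hε₀ (fun ε hε hlt => by
        refine (Real.log_le_iff_le_exp (hf_pos ε hε)).1 ?_
        have h1 : ε ^ β * Real.log (f ε) < -(r * c) := h ⟨hε, hlt⟩
        have hp := Real.rpow_pos_of_pos hε β
        rw [Real.rpow_neg hε.le, ← div_eq_mul_inv, ← neg_div, le_div_iff₀ hp]
        linarith)
    have hlog : Tendsto (fun x : ℝ => x ^ (-(β / (1 + β))) * Real.log K - r * sInf S) atTop
        (nhds (0 * Real.log K - r * sInf S)) :=
      ((tendsto_rpow_neg_atTop hγ).mul_const _).sub_const _
    filter_upwards [hlog.eventually_lt_const (show _ < b by linarith), hup,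
      hlow 2 1 one_lt_two one_pos, eventually_gt_atTop 0] with x h1 h2 h2' hx
    have hs := Real.rpow_pos_of_pos hx (-(1 / (1 + β)))
    have hI : 0 < ∫ ε in Ioi (0 : ℝ), Real.exp (-(x * ε)) * f ε :=
      lt_of_lt_of_le (by norm_num; positivity) h2'
    have h3 := Real.log_le_log hI h2
    rw [Real.log_mul hK.ne' (Real.exp_pos _).ne', Real.log_exp] at h3
    have h4 := mul_le_mul_of_nonneg_left h3 (Real.rpow_nonneg hx.le (-(β / (1 + β))))
    refine (h4.trans (le_of_eq ?_)).trans_lt h1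
    linear_combination -r * sInf S * hpow x hx
end
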